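/- arXiv:2311.12231 — 2 statements merged into one kernel-verified Lean document; each statement's English description precedes it below -/
import Mathlib

section
/- Let V be an n-dimensional real vector space, B ⊂ V a convex body containing 0 in its interior, 2 ≤ k < n an integer, and 𝒰 ⊂ Gr_k V a nonempty connected open set of k-dimensional linear subspaces. Suppose that for every X ∈ 𝒰 the body B is contained in a k-cylinder with base B ∩ X. Then there exists a set B' ⊂ V such that B ∩ X = B' ∩ X for all X ∈ 𝒰 and at least one of the following holds: (1) B' is a k-cylinder; (2) B' = {v ∈ V : Q(v) ≤ 1} for some nonnegative definite quadratic form Q on V. -/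
open Module Set Pointwise

/-- The Grassmannian of `k`-dimensional linear subspaces of `V`. -/
abbrev Gr (k : ℕ) (V : Type*) [AddCommGroup V] [Module ℝ V] :=
  {X : Submodule ℝ V // Module.finrank ℝ X = k}

/-- The standard (quotient) topology on the Grassmannian, coinduced from the space of
linearly independent `k`-tuples of vectors. -/
noncomputable instance grTop (k : ℕ) (V : Type*) [AddCommGroup V] [Module ℝ V]
    [TopologicalSpace V] : TopologicalSpace (Gr k V) :=
  TopologicalSpace.coinduced
    (fun v : {v : Fin k → V // LinearIndependent ℝ v} =>
      (⟨Submodule.span ℝ (Set.range v.1), by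
          rw [finrank_span_eq_card v.2, Fintype.card_fin]⟩ : Gr k V))
    inferInstance

/-- A convex body: a compact convex set with nonempty interior. -/
def IsConvexBody {V : Type*} [AddCommGroup V] [Module ℝ V] [TopologicalSpace V]
    (B : Set V) : Prop :=
  IsCompact B ∧ Convex ℝ B ∧ (interior B).Nonempty

/-- `C` is a `k`-cylinder with base `K` lying in the `k`-dimensional subspace `X`:
`K` is a `k`-dimensional convex body in `X` and `C = K + Y` for some complement `Y` of `X`. -/
def IsCylinderWithBase {V : Type*} [AddCommGroup V] [Module ℝ V] [TopologicalSpace V]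
    (k : ℕ) (C K : Set V) (X : Submodule ℝ V) : Prop :=
  Module.finrank ℝ X = k ∧ K ⊆ (X : Set V) ∧ IsCompact K ∧ Convex ℝ K ∧
    (interior ((↑) ⁻¹' K : Set X)).Nonempty ∧
    ∃ Y : Submodule ℝ V, IsCompl X Y ∧ C = K + (Y : Set V)

/-- `C` is a `k`-cylinder. -/
def IsCylinder {V : Type*} [AddCommGroup V] [Module ℝ V] [TopologicalSpace V]
    (k : ℕ) (C : Set V) : Prop :=
  ∃ (K : Set V) (X : Submodule ℝ V), IsCylinderWithBase k C K X

/-- Two sets coincide near a subspace `X`. -/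
def CoincideNear {V : Type*} [AddCommGroup V] [Module ℝ V] [TopologicalSpace V]
    (B₁ B₂ : Set V) (X : Submodule ℝ V) : Prop :=
  ∃ U : Set V, IsOpen U ∧ (X : Set V) ⊆ U ∧ B₁ ∩ U = B₂ ∩ U

/-- `B` is locally cylindrical near `X`. -/
def IsLocallyCylindricalNear {V : Type*} [AddCommGroup V] [Module ℝ V] [TopologicalSpace V]
    (k : ℕ) (B : Set V) (X : Submodule ℝ V) : Prop :=
  ∃ C : Set V, IsCylinder k C ∧ CoincideNear B C X

/-- A Minkowski seminorm: nonnegative, positively 1-homogeneous and subadditive. -/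
def IsMinkowskiSeminorm {V : Type*} [AddCommGroup V] [Module ℝ V] (Φ : V → ℝ) : Prop :=
  (∀ v, 0 ≤ Φ v) ∧ (∀ (c : ℝ) (v : V), 0 ≤ c → Φ (c • v) = c * Φ v) ∧
    ∀ v w, Φ (v + w) ≤ Φ v + Φ w

/-- A Minkowski norm: a Minkowski seminorm positive outside the origin. -/
def IsMinkowskiNorm {V : Type*} [AddCommGroup V] [Module ℝ V] (Φ : V → ℝ) : Prop :=
  IsMinkowskiSeminorm Φ ∧ ∀ v : V, v ≠ 0 → 0 < Φ v

/-- `X` is `Φ`-contracting with contracting direction `Y`. -/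
def IsContractingWithDirection {V : Type*} [AddCommGroup V] [Module ℝ V]
    (Φ : V → ℝ) (X Y : Submodule ℝ V) : Prop :=
  ∃ h : IsCompl X Y, ∀ v : V, Φ (X.linearProjOfIsCompl Y h v : V) ≤ Φ v

/-- `X` is `Φ`-contracting: there is a linear projector of `V` onto `X`
that does not increase `Φ`. -/
def IsContracting {V : Type*} [AddCommGroup V] [Module ℝ V]
    (Φ : V → ℝ) (X : Submodule ℝ V) : Prop :=
  ∃ P : V →ₗ[ℝ] V, P ∘ₗ P = P ∧ LinearMap.range P = X ∧ ∀ v, Φ (P v) ≤ Φ v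

/-- `K` is a 0-centered ellipsoid in the subspace `X`: the unit ball of an
inner product norm on `X`. -/
def IsEllipsoidIn {V : Type*} [AddCommGroup V] [Module ℝ V]
    (X : Submodule ℝ V) (K : Set V) : Prop :=
  ∃ Q : QuadraticForm ℝ X, Q.PosDef ∧ K = (↑) '' {x : X | Q x ≤ 1}

namespace LBK
open Filter Topology

/-- Minkowski norm comparable with the norm. -/
structure IsMN {V : Type*} [NormedAddCommGroup V] [NormedSpace ℝ V] (Φ : V → ℝ) : Prop where
  hom : ∀ (c : ℝ) (v : V), 0 ≤ c → Φ (c • v) = c * Φ v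
  sub : ∀ v w, Φ (v + w) ≤ Φ v + Φ w
  low : ∃ m : ℝ, 0 < m ∧ ∀ v, m * ‖v‖ ≤ Φ v
  up : ∃ M : ℝ, 0 < M ∧ ∀ v, Φ v ≤ M * ‖v‖

variable {V : Type*} [NormedAddCommGroup V] [NormedSpace ℝ V]

namespace IsMN
variable {Φ : V → ℝ}

theorem zero (h : IsMN Φ) : Φ 0 = 0 := by
  have := h.hom 0 0 le_rfl
  simpa using this

theorem nonneg (h : IsMN Φ) (v : V) : 0 ≤ Φ v := by
  obtain ⟨m, hm, hl⟩ := h.low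
  exact le_trans (by positivity) (hl v)

theorem pos (h : IsMN Φ) {v : V} (hv : v ≠ 0) : 0 < Φ v := by
  obtain ⟨m, hm, hl⟩ := h.low
  exact lt_of_lt_of_le (mul_pos hm (norm_pos_iff.2 hv)) (hl v)

theorem eq_zero (h : IsMN Φ) {v : V} (hv : Φ v = 0) : v = 0 := by
  by_contra hne
  exact (h.pos hne).ne' hv

theorem lip (h : IsMN Φ) : ∃ M : ℝ, 0 < M ∧ ∀ v w, |Φ v - Φ w| ≤ M * ‖v - w‖ := by
  obtain ⟨M, hM, hu⟩ := h.up
  refine ⟨M, hM, fun v w => ?_⟩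
  have h1 := h.sub (v - w) w
  have h2 := h.sub (w - v) v
  have h3 := hu (v - w)
  have h4 := hu (w - v)
  rw [norm_sub_rev] at h4
  simp only [sub_add_cancel] at h1 h2
  rw [abs_le]; constructor <;> linarith

theorem cont (h : IsMN Φ) : Continuous Φ := by
  obtain ⟨M, hM, hu⟩ := h.lip
  refine LipschitzWith.continuous (K := ⟨M, hM.le⟩) (LipschitzWith.of_dist_le_mul fun v w => ?_)
  rw [Real.dist_eq, dist_eq_norm]; exact hu v w

/-- a local minimum along a line is global -/
theorem ge_of_local (h : IsMN Φ) {x w : V} {ε : ℝ} (hε : 0 < ε)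
    (hl : ∀ t : ℝ, |t| < ε → Φ x ≤ Φ (x + t • w)) (t : ℝ) : Φ x ≤ Φ (x + t • w) := by
  obtain ⟨s, hs0, hs1, hst⟩ : ∃ s : ℝ, 0 < s ∧ s ≤ 1 ∧ |s * t| < ε := by
    refine ⟨min 1 (ε / (2 * (|t| + 1))), by positivity, min_le_left _ _, ?_⟩
    rw [abs_mul, abs_of_pos (by positivity)]
    calc _ ≤ (ε / (2 * (|t| + 1))) * |t| := by gcongr; exact min_le_right _ _
      _ = ε * (|t| / (2 * (|t| + 1))) := by ring
      _ < ε * 1 := by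
        gcongr
        rw [div_lt_one (by positivity)]
        have := abs_nonneg t; linarith
      _ = ε := mul_one _
  have h1 := hl _ hst
  have h2 := h.sub ((1 - s) • x) (s • (x + t • w))
  rw [h.hom _ _ (by linarith), h.hom _ _ hs0.le] at h2
  have e : (1 - s) • x + s • (x + t • w) = x + (s * t) • w := by module
  rw [e] at h2
  have : s * Φ x ≤ s * Φ (x + t • w) := by linarith
  exact le_of_mul_le_mul_left this hs0

/-- subgradient -/
theorem exists_sub [FiniteDimensional ℝ V] (h : IsMN Φ) (x : V) :
    ∃ f : V →ₗ[ℝ] ℝ, (∀ v, f v ≤ Φ v) ∧ f x = Φ x := by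
  by_cases hx : x = 0
  · subst hx
    exact ⟨0, fun v => by simpa using h.nonneg v, by simp [h.zero]⟩
  let p : V →ₗ.[ℝ] ℝ := LinearPMap.mkSpanSingleton x (Φ x) hx
  obtain ⟨g, hg1, hg2⟩ := exists_extension_of_le_sublinear p Φ
    (fun c hc v => h.hom c v hc.le) h.sub (by
      rintro ⟨v, hv⟩
      obtain ⟨c, rfl⟩ := Submodule.mem_span_singleton.1 hv
      have hval : p ⟨c • x, hv⟩ = c * Φ x :=
        LinearPMap.mkSpanSingleton'_apply x (Φ x) _ c hv
      rw [hval]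
      show c * Φ x ≤ Φ (c • x)
      rcases le_total 0 c with hc | hc
      · rw [h.hom _ _ hc]
      · have := h.nonneg (c • x)
        have := h.nonneg x
        nlinarith)
  refine ⟨g, hg2, ?_⟩
  have := hg1 ⟨x, Submodule.mem_span_singleton_self x⟩
  rw [this]
  exact LinearPMap.mkSpanSingleton_apply ℝ ℝ hx (Φ x)

end IsMN

/-- `P` is a `Φ`-nonincreasing projector onto `X`. -/
structure Contr (Φ : V → ℝ) (X : Submodule ℝ V) (P : V →L[ℝ] V) : Prop where
  mem : ∀ v, P v ∈ X
  fix : ∀ x ∈ X, P x = x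
  le : ∀ v, Φ (P v) ≤ Φ v

theorem Contr.bound {Φ : V → ℝ} (h : IsMN Φ) :
    ∃ C : ℝ, 0 < C ∧ ∀ P : V →L[ℝ] V, (∀ v, Φ (P v) ≤ Φ v) → ‖P‖ ≤ C := by
  obtain ⟨m, hm, hl⟩ := h.low
  obtain ⟨M, hM, hu⟩ := h.up
  refine ⟨M / m, by positivity, fun P hP => ?_⟩
  refine ContinuousLinearMap.opNorm_le_bound _ (by positivity) fun v => ?_
  have h1 := hl (P v)
  have h2 := hu v
  have h3 := hP v
  rw [div_mul_eq_mul_div, le_div_iff₀ hm]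
  linarith

/-- the plane `{x + λ x • y}` -/
def Xg (X : Submodule ℝ V) (l : V →L[ℝ] ℝ) (y : V) : Submodule ℝ V :=
  X.map ((1 + l.smulRight y : V →L[ℝ] V) : V →ₗ[ℝ] V)

theorem mem_Xg {X : Submodule ℝ V} {l : V →L[ℝ] ℝ} {y v : V} :
    v ∈ Xg X l y ↔ ∃ x ∈ X, x + l x • y = v := by
  simp [Xg]

/-- A locally open family of contracting planes. -/
structure Fam (Φ : V → ℝ) (k : ℕ) (G : Submodule ℝ V → Prop) : Prop where
  rank : ∀ X, G X → Module.finrank ℝ X = k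
  contr : ∀ X, G X → ∃ P : V →L[ℝ] V, Contr Φ X P
  opn : ∀ X, G X → ∀ᶠ T : V →L[ℝ] V in 𝓝 1, G (X.map (T : V →ₗ[ℝ] V))

theorem Fam.opn_l {Φ : V → ℝ} {k : ℕ} {G : Submodule ℝ V → Prop} (F : Fam Φ k G)
    {X : Submodule ℝ V} (hX : G X) (y : V) :
    ∃ r : ℝ, 0 < r ∧ ∀ l : V →L[ℝ] ℝ, ‖l‖ < r → G (Xg X l y) := by
  have h := F.opn X hX
  rw [Metric.eventually_nhds_iff] at h
  obtain ⟨e, he, h⟩ := h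
  refine ⟨e / (‖y‖ + 1), by positivity, fun l hl => h ?_⟩
  rw [dist_eq_norm, add_sub_cancel_left, ContinuousLinearMap.norm_smulRight_apply]
  rw [lt_div_iff₀ (by positivity)] at hl
  have := norm_nonneg l
  nlinarith

/-- a line point with prescribed nonzero derivative -/
theorem exists_diff_point {Φ : V → ℝ} [FiniteDimensional ℝ V] (h : IsMN Φ) (xb d : V) (hd : d ≠ 0) :
    ∃ (t0 c : ℝ), c ≠ 0 ∧ ∀ f : V →ₗ[ℝ] ℝ, (∀ v, f v ≤ Φ v) →
      f (xb + t0 • d) = Φ (xb + t0 • d) → f d = c := by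
  obtain ⟨m, hm, hl⟩ := h.low
  obtain ⟨M, hM, hu⟩ := h.up
  have hdp : 0 < ‖d‖ := norm_pos_iff.2 hd
  let g : ℝ → ℝ := fun t => Φ (xb + t • d)
  have hgc : Continuous g := h.cont.comp (by fun_prop)
  -- a non-minimizer
  obtain ⟨s, hs⟩ : ∃ s : ℝ, g 0 < g s := by
    refine ⟨(M * ‖xb‖ / m + ‖xb‖ + 1) / ‖d‖, ?_⟩
    have h1 : g 0 ≤ M * ‖xb‖ := by simpa [g] using hu xb
    refine lt_of_le_of_lt h1 (lt_of_lt_of_le ?_ (hl _))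
    have h2 : ‖((M * ‖xb‖ / m + ‖xb‖ + 1) / ‖d‖) • d‖ = M * ‖xb‖ / m + ‖xb‖ + 1 := by
      rw [norm_smul, Real.norm_eq_abs, abs_of_nonneg (by positivity)]
      field_simp
    have h3 := norm_sub_le_norm_add (((M * ‖xb‖ / m + ‖xb‖ + 1) / ‖d‖) • d) xb
    rw [h2, add_comm _ xb] at h3
    have h4 : m * (M * ‖xb‖ / m + 1) ≤ m * ‖xb + ((M * ‖xb‖ / m + ‖xb‖ + 1) / ‖d‖) • d‖ := by
      gcongr; linarith
    refine lt_of_lt_of_le ?_ h4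
    have : m * (M * ‖xb‖ / m + 1) = M * ‖xb‖ + m := by field_simp
    linarith
  -- minimize (t-s)^2 - g t
  obtain ⟨t0, ht0⟩ : ∃ t0, ∀ t, (t0 - s)^2 - g t0 ≤ (t - s)^2 - g t := by
    have hc : Continuous (fun t => (t - s)^2 - g t) := by fun_prop
    refine hc.exists_forall_le ?_
    have hlow : ∀ t, (|t - s| - M * ‖d‖) * |t - s| - M * ‖xb + s • d‖ ≤ (t - s)^2 - g t := by
      intro t
      have h1 : g t ≤ M * ‖xb + t • d‖ := hu _
      have h2 : ‖xb + t • d‖ ≤ ‖xb + s • d‖ + |t - s| * ‖d‖ := by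
        have : xb + t • d = (xb + s • d) + (t - s) • d := by module
        rw [this]
        refine (norm_add_le _ _).trans ?_
        rw [norm_smul, Real.norm_eq_abs]
      have h3 : M * ‖xb + t • d‖ ≤ M * (‖xb + s • d‖ + |t - s| * ‖d‖) := by gcongr
      have h4 : (t - s)^2 = |t - s| * |t - s| := by rw [← sq, sq_abs]
      rw [h4]; linarith
    refine tendsto_atTop_mono hlow ?_
    have ht : Tendsto (fun t : ℝ => |t - s|) (cocompact ℝ) atTop := by
      have : Tendsto (fun t : ℝ => ‖t - s‖) (cocompact ℝ) atTop :=
        tendsto_norm_cocompact_atTop.comp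
          (Homeomorph.subRight s).isClosedEmbedding.tendsto_cocompact
      simpa [Real.norm_eq_abs] using this
    refine tendsto_atTop_add_const_right _ _ ?_
    exact (tendsto_atTop_add_const_right _ _ ht).atTop_mul_atTop₀ ht
  have key : ∀ f : V →ₗ[ℝ] ℝ, (∀ v, f v ≤ Φ v) →
      f (xb + t0 • d) = Φ (xb + t0 • d) → f d = 2 * (t0 - s) := by
    intro f hf1 hf2
    have h1 : ∀ e : ℝ, e * f d ≤ e * (e + 2 * (t0 - s)) := by
      intro e
      have h2 := ht0 (t0 + e)
      have h3 := hf1 (xb + (t0 + e) • d)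
      have h4 : xb + (t0 + e) • d = (xb + t0 • d) + e • d := by module
      rw [h4, map_add, map_smul, hf2, ← h4, smul_eq_mul] at h3
      simp only [g] at h2
      nlinarith
    by_contra hne
    set D := f d - 2 * (t0 - s) with hD
    have hDne : D ≠ 0 := sub_ne_zero.2 hne
    have h5 := h1 (D / 2)
    have : 0 < D ^ 2 := by positivity
    nlinarith
  refine ⟨t0, 2 * (t0 - s), ?_, key⟩
  intro h0
  obtain ⟨f, hf1, hf2⟩ := h.exists_sub (xb + t0 • d)
  have hfd := key f hf1 hf2
  have hts : t0 = s := by linarith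
  have h1 := hf1 xb
  rw [map_add, map_smul, hfd, h0, smul_zero, add_zero] at hf2
  rw [hf2, hts] at h1
  simp only [g, zero_smul, add_zero] at hs
  linarith

theorem uniq_aux [FiniteDimensional ℝ V] {Φ : V → ℝ} {k : ℕ} {G : Submodule ℝ V → Prop}
    (h : IsMN Φ) (hk : 2 ≤ k)
    (F : Fam Φ k G) {X : Submodule ℝ V} (hX : G X) {P : V →L[ℝ] V} (hP : Contr Φ X P)
    {y : V} (hy : P y = 0) {u : V} (hu : u ∈ X)
    (hc : ∀ x ∈ X, ∀ t : ℝ, Φ x ≤ Φ (x + t • (y - u))) : u = 0 := by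
  by_contra hu0
  -- a vector of X outside ℝ u
  obtain ⟨xb, hxb, hxbu⟩ : ∃ xb ∈ X, xb ∉ Submodule.span ℝ {u} := by
    by_contra hcon
    push Not at hcon
    have h1 : X ≤ Submodule.span ℝ {u} := hcon
    have h2 := Submodule.finrank_mono h1
    rw [F.rank X hX] at h2
    have := finrank_span_le_card (R := ℝ) ({u} : Set V)
    simp at this
    omega
  obtain ⟨t0, c, hc0, hdiff⟩ := exists_diff_point h xb u hu0
  set x := xb + t0 • u with hx
  have hxX : x ∈ X := X.add_mem hxb (X.smul_mem _ hu)
  have hux : u ∉ Submodule.span ℝ {x} := by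
    intro hmem
    obtain ⟨a, ha⟩ := Submodule.mem_span_singleton.1 hmem
    have ha0 : a ≠ 0 := by rintro rfl; simp at ha; exact hu0 ha.symm
    apply hxbu
    rw [Submodule.mem_span_singleton]
    refine ⟨a⁻¹ - t0, ?_⟩
    have : x = a⁻¹ • u := by rw [← ha, smul_smul, inv_mul_cancel₀ ha0, one_smul]
    rw [hx] at this
    rw [sub_smul, ← this]; abel
  -- functional l with l x = 0, l u = 1, l ∘ P = l
  obtain ⟨l0, hl0u, hl0x⟩ := Submodule.exists_dual_map_eq_bot_of_notMem hux inferInstance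
  have hl0x' : l0 x = 0 := by
    have : l0 x ∈ (Submodule.span ℝ {x}).map l0 :=
      Submodule.mem_map_of_mem (Submodule.mem_span_singleton_self x)
    rw [hl0x] at this; simpa using this
  let l : V →L[ℝ] ℝ := ((l0 u)⁻¹ • LinearMap.toContinuousLinearMap l0).comp P
  have hlx : l x = 0 := by simp [l, hP.fix x hxX, hl0x']
  have hlu : l u = 1 := by simp [l, hP.fix u hu, hl0u]
  obtain ⟨r, hr, hG⟩ := F.opn_l hX y
  obtain ⟨C, hC, hCb⟩ := Contr.bound h
  obtain ⟨e, he0, he1, he2⟩ : ∃ e : ℝ, 0 < e ∧ e * ‖l‖ < r ∧ e * ((C + 1) * ‖y‖ * ‖l‖) < 1 := by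
    refine ⟨min (r / (‖l‖ + 1)) (1 / ((C + 1) * ‖y‖ * ‖l‖ + 1)), by positivity, ?_, ?_⟩
    · calc _ ≤ (r / (‖l‖ + 1)) * ‖l‖ := by gcongr; exact min_le_left _ _
        _ < r := by rw [div_mul_eq_mul_div, div_lt_iff₀ (by positivity)]; nlinarith
    · calc _ ≤ (1 / ((C + 1) * ‖y‖ * ‖l‖ + 1)) * ((C + 1) * ‖y‖ * ‖l‖) := by
            gcongr; exact min_le_right _ _
        _ < 1 := by rw [div_mul_eq_mul_div, div_lt_iff₀ (by positivity)]; linarith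
  have hGe := hG (e • l) (by rw [norm_smul, Real.norm_eq_abs, abs_of_pos he0]; exact he1)
  obtain ⟨Pe, hPe⟩ := F.contr _ hGe
  obtain ⟨f, hf1, hf2⟩ := h.exists_sub x
  have hxe : Pe x = x := hPe.fix x (mem_Xg.2 ⟨x, hxX, by simp [hlx]⟩)
  -- f1 = f ∘ P ∘ Pe
  obtain ⟨x', hx', hx'e⟩ := mem_Xg.1 (hPe.mem u)
  simp only [smul_apply, smul_eq_mul] at hx'e
  set τ := e * l x' with hτ
  have g1 : f (P (Pe u)) = c := by
    refine hdiff (f ∘ₗ (P : V →ₗ[ℝ] V) ∘ₗ (Pe : V →ₗ[ℝ] V)) (fun v => ?_) ?_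
    · exact (hf1 _).trans ((hP.le _).trans (hPe.le v))
    · simp [hxe, hP.fix x hxX, hf2]
  have g2 : f (P (Pe u)) + τ * f u = c := by
    -- second functional: v ↦ f (P v) + ξ v f u on W
    obtain ⟨f2, hf2a⟩ : ∃ f2 : V →ₗ[ℝ] ℝ, ∀ v, f2 v = f (P (Pe v)) + l (Pe v) * (e * f u) :=
      ⟨f ∘ₗ (P : V →ₗ[ℝ] V) ∘ₗ (Pe : V →ₗ[ℝ] V) +
        (e * f u) • ((l : V →ₗ[ℝ] ℝ) ∘ₗ (Pe : V →ₗ[ℝ] V)), fun v => by simp; ring⟩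
    have hlP : ∀ v, l (P v) = l v := fun v => by simp [l, hP.fix _ (hP.mem v)]
    have hly : l y = 0 := by rw [← hlP, hy, map_zero]
    have hfin := hdiff f2 (fun v => ?_) ?_
    · rw [hf2a] at hfin
      rw [← hfin, ← hx'e]
      simp [hy, hly, hP.fix x' hx']
      rw [hτ]; ring
    · obtain ⟨z, hz, hze⟩ := mem_Xg.1 (hPe.mem v)
      simp only [smul_apply, smul_eq_mul] at hze
      rw [hf2a, ← hze]
      simp only [map_add, map_smul, hy, hly, hP.fix z hz, smul_zero, add_zero]
      have q1 := hf1 (z + (e * l z) • u)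
      have q2 := hc (z + (e * l z) • u) (X.add_mem hz (X.smul_mem _ hu)) (e * l z)
      have q3 : z + (e * l z) • u + (e * l z) • (y - u) = z + (e * l z) • y := by module
      rw [q3, hze] at q2
      have q4 := hPe.le v
      simp only [map_add, map_smul, smul_eq_mul] at q1
      linarith
    · rw [hf2a, hxe, hP.fix x hxX, hlx, hf2]; ring
  have hfu : f u = c := hdiff f hf1 hf2
  have hτ0 : τ = 0 := by
    have : τ * c = 0 := by rw [← hfu]; rw [hfu]; linarith [hfu ▸ g2]
    exact (mul_eq_zero.1 this).resolve_right hc0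
  have hlx' : l x' = 0 := (mul_eq_zero.1 (hτ ▸ hτ0 : e * l x' = 0)).resolve_left he0.ne'
  rw [hτ0, zero_smul, add_zero] at hx'e
  -- w = u - x'
  have hw1 : Pe (u - x') = 0 := by
    rw [hx'e, map_sub, hPe.fix (Pe u) (hPe.mem u), sub_self]
  have hlw : l (u - x') = 1 := by rw [map_sub, hlu, hlx', sub_zero]
  have hw2 : Pe ((u - x') + e • y) = (u - x') + e • y := by
    refine hPe.fix _ (mem_Xg.2 ⟨u - x', X.sub_mem hu hx', ?_⟩)
    simp [hlu, hlx']
  rw [map_add, hw1, zero_add, map_smul] at hw2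
  have hw3 : u - x' = e • (Pe y - y) := by rw [smul_sub, hw2]; abel
  have hw4 : ‖u - x'‖ ≤ e * ((C + 1) * ‖y‖) := by
    rw [hw3, norm_smul, Real.norm_eq_abs, abs_of_pos he0]
    gcongr
    refine (norm_sub_le _ _).trans ?_
    have := Pe.le_of_opNorm_le (hCb Pe hPe.le) y
    linarith
  have hw5 : (1 : ℝ) ≤ ‖l‖ * ‖u - x'‖ := by
    have := l.le_opNorm (u - x')
    rw [hlw] at this; simpa using this
  have hw6 : ‖l‖ * ‖u - x'‖ ≤ ‖l‖ * (e * ((C + 1) * ‖y‖)) := by gcongr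
  nlinarith

theorem uniq [FiniteDimensional ℝ V] {Φ : V → ℝ} {k : ℕ} {G : Submodule ℝ V → Prop}
    (h : IsMN Φ) (hk : 2 ≤ k)
    (F : Fam Φ k G) {X : Submodule ℝ V} (hX : G X) {P P' : V →L[ℝ] V} (hP : Contr Φ X P)
    (hP' : Contr Φ X P') : P' = P := by
  ext y
  have h1 : P (y - P y) = 0 := by rw [map_sub, hP.fix _ (hP.mem y), sub_self]
  have h2 := uniq_aux h hk F hX hP h1 (u := P' (y - P y)) (hP'.mem _) (by
    intro x hx t
    have := hP'.le (x + t • (y - P y - P' (y - P y)))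
    rwa [map_add, map_smul, map_sub _ (y - P y), hP'.fix _ (hP'.mem (y - P y)), sub_self, smul_zero,
      add_zero, hP'.fix x hx] at this)
  rw [map_sub, hP'.fix _ (hP.mem y), sub_eq_zero] at h2
  exact h2

end LBK

namespace LBK
open Filter Topology
variable {V : Type*} [NormedAddCommGroup V] [NormedSpace ℝ V]

theorem tends_app {A : Type*} {l : Filter A} {P : A → V →L[ℝ] V} {P0 : V →L[ℝ] V} {f : A → V}
    {x : V} (hP : Tendsto P l (𝓝 P0)) (hf : Tendsto f l (𝓝 x)) :
    Tendsto (fun a => P a (f a)) l (𝓝 (P0 x)) :=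
  ((isBoundedBilinearMap_apply (𝕜 := ℝ) (E := V) (F := V)).continuous.tendsto (P0, x)).comp
    (hP.prodMk_nhds hf)

theorem tendsto_proj [FiniteDimensional ℝ V] {Φ : V → ℝ} {k : ℕ} {G : Submodule ℝ V → Prop}
    (h : IsMN Φ) (hk : 2 ≤ k) (F : Fam Φ k G) {A : Type*} {l : Filter A}
    {T : A → V →L[ℝ] V} {T0 : V →L[ℝ] V} (hT : Tendsto T l (𝓝 T0)) {X : Submodule ℝ V}
    {P : A → V →L[ℝ] V} {P0 : V →L[ℝ] V}
    (hP : ∀ᶠ a in l, Contr Φ (X.map (T a : V →ₗ[ℝ] V)) (P a) ∧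
      finrank ℝ (X.map (T a : V →ₗ[ℝ] V)) = k)
    (hX0 : G (X.map (T0 : V →ₗ[ℝ] V))) (hP0 : Contr Φ (X.map (T0 : V →ₗ[ℝ] V)) P0) :
    Tendsto P l (𝓝 P0) := by
  obtain ⟨C, hC, hCb⟩ := Contr.bound h
  rw [tendsto_iff_ultrafilter]
  intro g hg
  have hPg := hP.filter_mono hg
  have hTg := hT.mono_left hg
  have hcomp : IsCompact (Metric.closedBall (0 : V →L[ℝ] V) C) := isCompact_closedBall _ _
  rw [isCompact_iff_ultrafilter_le_nhds] at hcomp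
  obtain ⟨P', -, hP'⟩ := hcomp (g.map P) (by
    rw [le_principal_iff]
    change ∀ᶠ a in (g : Filter A), P a ∈ Metric.closedBall (0 : V →L[ℝ] V) C
    filter_upwards [hPg] with a ha
    rw [mem_closedBall_zero_iff]
    exact hCb _ ha.1.le)
  have hlim : Tendsto P g (𝓝 P') := hP'
  have hev : ∀ v, Tendsto (fun a => P a v) g (𝓝 (P' v)) := fun v =>
    ((ContinuousLinearMap.apply ℝ V v).continuous.tendsto P').comp hlim
  have hle : ∀ v, Φ (P' v) ≤ Φ v := fun v =>
    le_of_tendsto ((h.cont.tendsto _).comp (hev v)) (hPg.mono fun a ha => ha.1.le v)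
  have hfix : ∀ x ∈ X.map (T0 : V →ₗ[ℝ] V), P' x = x := by
    rintro _ ⟨x, hx, rfl⟩
    have t1 : Tendsto (fun a => T a x) g (𝓝 (T0 x)) :=
      ((ContinuousLinearMap.apply ℝ V x).continuous.tendsto T0).comp hTg
    have t2 : Tendsto (fun a => P a (T a x)) g (𝓝 (P' (T0 x))) :=
      tends_app hlim t1
    refine tendsto_nhds_unique_of_eventuallyEq t2 t1 ?_
    filter_upwards [hPg] with a ha
    exact ha.1.fix _ ⟨x, hx, rfl⟩
  have hidem : ∀ v, P' (P' v) = P' v := by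
    intro v
    have t2 : Tendsto (fun a => P a (P a v)) g (𝓝 (P' (P' v))) :=
      tends_app hlim (hev v)
    refine tendsto_nhds_unique_of_eventuallyEq t2 (hev v) ?_
    filter_upwards [hPg] with a ha
    exact ha.1.fix _ (ha.1.mem v)
  have htr : LinearMap.trace ℝ V (P' : V →ₗ[ℝ] V) = k := by
    have hc : Continuous (fun Q : V →L[ℝ] V => LinearMap.trace ℝ V (Q : V →ₗ[ℝ] V)) :=
      LinearMap.continuous_of_finiteDimensional
        ((LinearMap.trace ℝ V).comp (ContinuousLinearMap.coeLM ℝ))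
    have t1 := (hc.tendsto P').comp hlim
    refine tendsto_nhds_unique_of_eventuallyEq t1 tendsto_const_nhds ?_
    filter_upwards [hPg] with a ha
    have : LinearMap.IsProj (X.map (T a : V →ₗ[ℝ] V)) (P a : V →ₗ[ℝ] V) := ⟨ha.1.mem, ha.1.fix⟩
    simp only [Function.comp]
    rw [this.trace, ha.2]
  have hproj : LinearMap.IsProj (LinearMap.range (P' : V →ₗ[ℝ] V)) (P' : V →ₗ[ℝ] V) :=
    ⟨fun v => ⟨v, rfl⟩, by rintro _ ⟨v, rfl⟩; exact hidem v⟩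
  have hrk : finrank ℝ (LinearMap.range (P' : V →ₗ[ℝ] V)) = k := by
    have := hproj.trace; rw [htr] at this; exact_mod_cast this.symm
  have heq : X.map (T0 : V →ₗ[ℝ] V) = LinearMap.range (P' : V →ₗ[ℝ] V) := by
    apply Submodule.eq_of_le_of_finrank_eq
    · intro x hx; exact ⟨x, hfix x hx⟩
    · rw [F.rank _ hX0, hrk]
  have : P' = P0 := uniq h hk F hX0 hP0 ⟨fun v => by rw [heq]; exact ⟨v, rfl⟩, hfix, hle⟩
  rw [← this]; exact hlim

/-- along a curve with velocity in the kernel, `Φ` is nondecreasing -/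
theorem energy_le {Φ : V → ℝ} (h : IsMN Φ) {a a' : ℝ → V} {P : ℝ → V →L[ℝ] V}
    (ha : ∀ t ∈ Icc (0:ℝ) 1, HasDerivAt a (a' t) t)
    (hP : ∀ t ∈ Icc (0:ℝ) 1, ∀ v, Φ (P t v) ≤ Φ v)
    (h1 : ∀ t ∈ Icc (0:ℝ) 1, P t (a t) = a t) (h2 : ∀ t ∈ Icc (0:ℝ) 1, P t (a' t) = 0) :
    Φ (a 0) ≤ Φ (a 1) := by
  obtain ⟨M, hM, hlip⟩ := h.lip
  have hcont : ContinuousOn (fun t => - Φ (a t)) (Icc 0 1) := by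
    have : ContinuousOn a (Icc 0 1) := fun t ht => (ha t ht).continuousAt.continuousWithinAt
    exact (h.cont.comp_continuousOn this).neg
  have := image_le_of_liminf_slope_right_le_deriv_boundary (f := fun t => - Φ (a t)) hcont
    (B := fun _ => - Φ (a 0)) (B' := fun _ => 0) le_rfl continuousOn_const
    (fun x _ => hasDerivWithinAt_const _ _ _) (by
      intro t ht r hr
      have ht' : t ∈ Icc (0:ℝ) 1 := Ico_subset_Icc_self ht
      apply Eventually.frequently
      have hd := (ha t ht').isLittleO
      have hd2 := hd.def (c := r / (2 * M * (‖P t‖ + 1))) (by positivity)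
      have hd3 := nhdsWithin_le_nhds (s := Ioi t) hd2
      filter_upwards [hd3, self_mem_nhdsWithin] with s hs hst
      have hst' : 0 < s - t := sub_pos.2 hst
      rw [slope_def_field, div_lt_iff₀ hst']
      rw [Real.norm_eq_abs, abs_of_pos hst'] at hs
      set R := a s - a t - (s - t) • a' t with hR
      have e1 : P t (a s) = a t + P t R := by
        rw [hR, map_sub, map_sub, map_smul, h1 t ht', h2 t ht']; simp
      have e2 := hP t ht' (a s)
      have e3 := hlip (a t + P t R) (a t)
      rw [add_sub_cancel_left, abs_le] at e3
      have e4 := (P t).le_opNorm R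
      rw [e1] at e2
      have e5 : M * ‖P t R‖ ≤ M * (‖P t‖ * (r / (2 * M * (‖P t‖ + 1)) * (s - t))) := by
        gcongr
        exact e4.trans (by gcongr)
      have e6 : M * (‖P t‖ * (r / (2 * M * (‖P t‖ + 1)) * (s - t)))
          = r * (s - t) * (‖P t‖ / (2 * (‖P t‖ + 1))) := by field_simp
      have e7 : ‖P t‖ / (2 * (‖P t‖ + 1)) < 1 := by
        rw [div_lt_one (by positivity)]; have := norm_nonneg (P t); linarith
      have e8 : r * (s - t) * (‖P t‖ / (2 * (‖P t‖ + 1))) < r * (s - t) * 1 := by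
        gcongr
      linarith [e3.1])
  have := this (right_mem_Icc.2 zero_le_one)
  simpa using this

theorem energy {Φ : V → ℝ} (h : IsMN Φ) {a a' : ℝ → V} {P : ℝ → V →L[ℝ] V}
    (ha : ∀ t ∈ Icc (0:ℝ) 1, HasDerivAt a (a' t) t)
    (hP : ∀ t ∈ Icc (0:ℝ) 1, ∀ v, Φ (P t v) ≤ Φ v)
    (h1 : ∀ t ∈ Icc (0:ℝ) 1, P t (a t) = a t) (h2 : ∀ t ∈ Icc (0:ℝ) 1, P t (a' t) = 0) :
    Φ (a 1) = Φ (a 0) := by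
  refine le_antisymm ?_ (energy_le h ha hP h1 h2)
  have hm : ∀ t ∈ Icc (0:ℝ) 1, 1 - t ∈ Icc (0:ℝ) 1 := fun t ht =>
    ⟨by linarith [ht.2], by linarith [ht.1]⟩
  have := energy_le h (a := fun t => a (1 - t)) (a' := fun t => - a' (1 - t))
    (P := fun t => P (1 - t)) (fun t ht => by
      have := (ha _ (hm t ht)).scomp t ((hasDerivAt_id t).const_sub 1)
      simpa [Function.comp_def] using this) (fun t ht => hP _ (hm t ht)) (fun t ht => h1 _ (hm t ht))
      (fun t ht => by simp [h2 _ (hm t ht)])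
  simpa using this

theorem mem_Xg' {Φ : V → ℝ} {X : Submodule ℝ V} {P1 : V →L[ℝ] V} (hP1 : Contr Φ X P1)
    {l : V →L[ℝ] ℝ} (hl : ∀ v, l (P1 v) = l v) {y v : V} (hy : P1 y = 0) :
    v ∈ Xg X l y ↔ v = P1 v + l v • y := by
  have hly : l y = 0 := by rw [← hl, hy, map_zero]
  rw [mem_Xg]
  constructor
  · rintro ⟨x, hx, rfl⟩
    simp [hP1.fix x hx, hy, hly]
  · intro hv
    exact ⟨P1 v, hP1.mem v, by rw [hl]; exact hv.symm⟩

/-- Parallel transport from `X_l` to `X_{l+m}`. -/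
theorem transport [FiniteDimensional ℝ V] {Φ : V → ℝ} (h : IsMN Φ) {X : Submodule ℝ V}
    {P1 : V →L[ℝ] V} (hP1 : Contr Φ X P1) {y : V} (hy : P1 y = 0)
    {l m : V →L[ℝ] ℝ} (hl : ∀ v, l (P1 v) = l v) (hm : ∀ v, m (P1 v) = m v)
    {P : ℝ → V →L[ℝ] V} (hPc : Continuous P)
    (hP : ∀ t ∈ Icc (0:ℝ) 1, Contr Φ (Xg X (l + t • m) y) (P t)) {C : ℝ} (hC : ∀ t, ‖P t‖ ≤ C) :
    ∃ w : V, ‖w‖ ≤ Real.exp (‖m‖ * ((1 + C) * ‖y‖)) * ((1 + C) * ‖y‖) ∧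
      ∀ v ∈ Xg X l y, v + m v • w ∈ Xg X (l + m) y ∧ Φ (v + m v • w) = Φ v := by
  have hC0 : 0 ≤ C := (norm_nonneg _).trans (hC 0)
  set η : ℝ → V := fun t => y - P t y with hη
  have hηc : Continuous η := by fun_prop
  have hηb : ∀ t, ‖η t‖ ≤ (1 + C) * ‖y‖ := fun t => by
    refine (norm_sub_le _ _).trans ?_
    have := (P t).le_of_opNorm_le (hC t) y
    linarith
  set D := (1 + C) * ‖y‖ with hD
  have hD0 : 0 ≤ D := by positivity
  set q : ℝ → ℝ := fun t => ∫ s in (0:ℝ)..t, m (η s) with hq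
  have hqd : ∀ t, HasDerivAt q (m (η t)) t := fun t =>
    intervalIntegral.integral_hasDerivAt_right ((by fun_prop : Continuous _).intervalIntegrable _ _)
      ((by fun_prop : Continuous fun s => m (η s)).stronglyMeasurableAtFilter _ _)
      (by fun_prop : Continuous fun s => m (η s)).continuousAt
  have hqc : Continuous q := continuous_iff_continuousAt.2 fun t => (hqd t).continuousAt
  set w : ℝ → V := fun t => ∫ s in (0:ℝ)..t, Real.exp (q s) • η s with hw
  have hwc0 : Continuous fun s => Real.exp (q s) • η s := by fun_prop
  have hwd : ∀ t, HasDerivAt w (Real.exp (q t) • η t) t := fun t =>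
    intervalIntegral.integral_hasDerivAt_right (hwc0.intervalIntegrable _ _)
      (hwc0.stronglyMeasurableAtFilter _ _) hwc0.continuousAt
  have hw0 : w 0 = 0 := by simp [hw]
  have hq0 : q 0 = 0 := by simp [hq]
  have hwc : Continuous w := continuous_iff_continuousAt.2 fun t => (hwd t).continuousAt
  -- 1 + m (w t) = exp (q t)
  have hmw : ∀ t ∈ Icc (0:ℝ) 1, 1 + m (w t) = Real.exp (q t) := by
    intro t ht
    have := constant_of_has_deriv_right_zero (f := fun t => 1 + m (w t) - Real.exp (q t))
      (a := 0) (b := 1) (by fun_prop) (fun x _ => by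
        have d1 := ((m.hasFDerivAt.comp_hasDerivAt x (hwd x)).const_add 1).sub (hqd x).exp
        simp only [map_smul, smul_eq_mul, sub_self] at d1
        exact d1.hasDerivWithinAt) t ht
    simp [hw0, hq0] at this
    linarith
  refine ⟨w 1, ?_, fun v hv => ?_⟩
  · have := intervalIntegral.norm_integral_le_of_norm_le_const (a := (0:ℝ)) (b := 1)
      (f := fun s => Real.exp (q s) • η s) (C := Real.exp (‖m‖ * D) * D) (fun s hs => by
        rw [uIoc_of_le zero_le_one] at hs
        rw [norm_smul, Real.norm_eq_abs, abs_of_pos (Real.exp_pos _)]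
        have hqs : q s ≤ ‖m‖ * D := by
          have h1 := intervalIntegral.norm_integral_le_of_norm_le_const (a := (0:ℝ)) (b := s)
            (f := fun s => m (η s)) (C := ‖m‖ * D) (fun s _ =>
              (m.le_opNorm _).trans (by gcongr; exact hηb s))
          rw [sub_zero, abs_of_pos hs.1] at h1
          have h2 : q s ≤ ‖m‖ * D * s := (le_abs_self _).trans h1
          have : ‖m‖ * D * s ≤ ‖m‖ * D * 1 := by gcongr; exact hs.2
          linarith
        gcongr
        exact hηb s)
    simpa using this
  · set a : ℝ → V := fun t => v + m v • w t with ha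
    have had : ∀ t, HasDerivAt a (m v • Real.exp (q t) • η t) t := fun t =>
      ((hwd t).const_smul (m v)).const_add v
    have hlm : ∀ t : ℝ, ∀ v, (l + t • m) (P1 v) = (l + t • m) v := fun t v => by
      simp [hl, hm]
    have hly : l y = 0 := by rw [← hl, hy, map_zero]
    have hmy : m y = 0 := by rw [← hm, hy, map_zero]
    have hac : Continuous a := by fun_prop
    have hmem : ∀ t ∈ Icc (0:ℝ) 1, a t ∈ Xg X (l + t • m) y := by
      intro t ht
      rw [mem_Xg' hP1 (hlm t) hy]
      have := constant_of_has_deriv_right_zero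
        (f := fun t => a t - P1 (a t) - (l (a t) + t * m (a t)) • y)
        (a := 0) (b := 1) (by fun_prop) (fun x hx => by
          have hx' : x ∈ Icc (0:ℝ) 1 := Ico_subset_Icc_self hx
          have d1 := had x
          have d2 := P1.hasFDerivAt.comp_hasDerivAt x d1
          have d3 := l.hasFDerivAt.comp_hasDerivAt x d1
          have d4 := m.hasFDerivAt.comp_hasDerivAt x d1
          have d5 := ((hasDerivAt_id x).mul d4)
          have d6 := ((d1.sub d2).sub ((d3.add d5).smul_const y)).hasDerivWithinAt (s := Ici x)
          refine d6.congr_deriv ?_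
          have e1 := (mem_Xg' hP1 (hlm x) hy).1 ((hP x hx').mem y)
          have e2 : m (a x) = m v * Real.exp (q x) := by
            rw [← hmw x hx']; simp [ha]; ring
          have e3 : P1 (η x) = - P1 (P x y) := by simp [hη, hy]
          have e4 : l (η x) + x * m (η x) = - (l + x • m) (P x y) := by
            simp [hη, hly, hmy]; ring
          have e5 : η x + P1 (P x y) + (l + x • m) (P x y) • y = y := by
            rw [hη]; simp only
            nth_rewrite 1 [e1]
            abel
          simp only [Function.comp, id, map_smul, smul_eq_mul, e2, e3, one_mul]
          have e6 : m v * (Real.exp (q x) * l (η x)) + (m v * Real.exp (q x) +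
              x * (m v * (Real.exp (q x) * m (η x)))) = m v * Real.exp (q x) *
              (1 + (l (η x) + x * m (η x))) := by ring
          rw [e6, e4]
          have e7 : m v • Real.exp (q x) • η x - m v • Real.exp (q x) • -P1 (P x y) -
            (m v * Real.exp (q x) * (1 + - (l + x • m) (P x y))) • y =
            (m v * Real.exp (q x)) • (η x + P1 (P x y) + (l + x • m) (P x y) • y - y) := by
              module
          rw [e7, e5, sub_self, smul_zero]) t ht
      simp only [ha, hw0, smul_zero, add_zero, zero_mul] at this
      have h0 := (mem_Xg' hP1 hl hy).1 hv
      have h0' : v - P1 v - l v • y = 0 := by nth_rewrite 1 [h0]; abel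
      rw [h0'] at this
      have e : (l + t • m) (a t) = l (a t) + t * m (a t) := by simp
      rw [e, ← sub_eq_zero, ← this]
      simp only [ha]; abel
    refine ⟨?_, ?_⟩
    · have := hmem 1 (right_mem_Icc.2 zero_le_one)
      rwa [one_smul] at this
    · have := energy h (a := a) (P := P) (fun t _ => had t) (fun t ht => (hP t ht).le)
        (fun t ht => (hP t ht).fix _ (hmem t ht)) (fun t ht => by
          simp [hη, (hP t ht).fix _ ((hP t ht).mem y)])
      simpa [ha, hw0] using this

/-- uniform transports -/
theorem transports [FiniteDimensional ℝ V] {Φ : V → ℝ} {k : ℕ} {G : Submodule ℝ V → Prop}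
    (h : IsMN Φ) (hk : 2 ≤ k) (F : Fam Φ k G) {X : Submodule ℝ V} (hX : G X)
    {P1 : V →L[ℝ] V} (hP1 : Contr Φ X P1) {y : V} (hy : P1 y = 0) :
    ∃ r D : ℝ, 0 < r ∧ 0 < D ∧ ∃ W : (V →L[ℝ] ℝ) → (V →L[ℝ] ℝ) → V,
      ∀ l l' : V →L[ℝ] ℝ, (∀ v, l (P1 v) = l v) → (∀ v, l' (P1 v) = l' v) → ‖l‖ < r → ‖l'‖ < r →
        ‖W l l'‖ ≤ D ∧ ∀ v ∈ Xg X l y, v + (l' - l) v • W l l' ∈ Xg X l' y ∧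
          Φ (v + (l' - l) v • W l l') = Φ v := by
  obtain ⟨r, hr, hG⟩ := F.opn_l hX y
  obtain ⟨C, hC, hCb⟩ := Contr.bound h
  suffices hs : ∀ l l' : V →L[ℝ] ℝ, ∃ w : V, (∀ v, l (P1 v) = l v) → (∀ v, l' (P1 v) = l' v) →
      ‖l‖ < r → ‖l'‖ < r →
        ‖w‖ ≤ Real.exp (2 * r * ((1 + C) * ‖y‖)) * ((1 + C) * ‖y‖) + 1 ∧
        ∀ v ∈ Xg X l y, v + (l' - l) v • w ∈ Xg X l' y ∧
          Φ (v + (l' - l) v • w) = Φ v by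
    choose W hW using hs
    exact ⟨r, _, hr, by positivity, W, hW⟩
  intro l l'
  by_cases hc : (∀ v, l (P1 v) = l v) ∧ (∀ v, l' (P1 v) = l' v) ∧ ‖l‖ < r ∧ ‖l'‖ < r
  swap
  · exact ⟨0, fun a b c d => (hc ⟨a, b, c, d⟩).elim⟩
  obtain ⟨hl, hl', hlr, hlr'⟩ := hc
  set m := l' - l with hm
  let cl : ℝ → ℝ := fun t => (projIcc (0:ℝ) 1 zero_le_one t : ℝ)
  have hclc : Continuous cl := continuous_subtype_val.comp continuous_projIcc
  have hball : ∀ t, ‖l + cl t • m‖ < r := by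
    intro t
    have hmem : cl t ∈ Icc (0:ℝ) 1 := (projIcc (0:ℝ) 1 zero_le_one t).2
    have := (convex_ball (0 : V →L[ℝ] ℝ) r).add_smul_sub_mem (mem_ball_zero_iff.2 hlr)
      (mem_ball_zero_iff.2 hlr') hmem
    rwa [mem_ball_zero_iff] at this
  choose P hP using fun t => F.contr _ (hG _ (hball t))
  have hPc : Continuous P := by
    rw [continuous_iff_continuousAt]
    intro t0
    refine tendsto_proj h hk F (T := fun t => 1 + (l + cl t • m).smulRight y)
      (T0 := 1 + (l + cl t0 • m).smulRight y) (X := X) ?_ ?_ ?_ (hP t0)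
    · have : Continuous (fun t => 1 + (l + cl t • m).smulRight y) := by
        have h1 : Continuous (fun t => (ContinuousLinearMap.smulRightL ℝ V V (l + cl t • m)) y) := by
          fun_prop
        exact continuous_const.add h1
      exact this.tendsto t0
    · exact Eventually.of_forall fun t => ⟨hP t, F.rank _ (hG _ (hball t))⟩
    · exact hG _ (hball t0)
  obtain ⟨w, hw1, hw2⟩ := transport h hP1 hy (m := m) hl (fun v => by simp [hm, hl, hl']) hPc
    (fun t ht => by
      have := hP t
      have e : cl t = t := by simp [cl, projIcc_of_mem zero_le_one ht]
      rwa [e] at this) (fun t => hCb _ (hP t).le)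
  refine ⟨w, fun _ _ _ _ => ⟨?_, ?_⟩⟩
  · have hm2 : ‖m‖ ≤ 2 * r := (norm_sub_le _ _).trans (by linarith)
    have : Real.exp (‖m‖ * ((1 + C) * ‖y‖)) * ((1 + C) * ‖y‖) ≤
      Real.exp (2 * r * ((1 + C) * ‖y‖)) * ((1 + C) * ‖y‖) := by gcongr
    linarith
  · intro v hv
    have := hw2 v hv
    rwa [hm, add_sub_cancel] at this

end LBK

namespace LBK
open Filter Topology
variable {V : Type*} [NormedAddCommGroup V] [NormedSpace ℝ V]

/-- near-identity isometries of `X` fixing the common kernel are trivial -/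
def Flat (Φ : V → ℝ) (X : Submodule ℝ V) (α β : V →L[ℝ] ℝ) : Prop :=
  ∃ ε : ℝ, 0 < ε ∧ ∀ g : V →L[ℝ] V, (∀ x ∈ X, g x ∈ X) → (∀ x ∈ X, Φ (g x) = Φ x) →
    (∀ x ∈ X, α x = 0 → β x = 0 → g x = x) → ‖g - 1‖ < ε → ∀ x ∈ X, g x = x

theorem norm_prod3 {R : Type*} [NormedRing R] {A B C : R} {d : ℝ} (h1 : d ≤ 1)
    (hA : ‖A‖ ≤ d) (hB : ‖B‖ ≤ d) (hC : ‖C‖ ≤ d) :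
    ‖(1 + C) * (1 + B) * (1 + A) - 1‖ ≤ 7 * d := by
  have e : (1 + C) * (1 + B) * (1 + A) - 1 = A + B + C + C * B + B * A + C * A + C * B * A := by
    noncomm_ring
  have hd : 0 ≤ d := (norm_nonneg _).trans hA
  have m1 : ∀ S T : R, ‖S‖ ≤ d → ‖T‖ ≤ d → ‖S * T‖ ≤ d := fun S T hS hT => by
    refine (norm_mul_le _ _).trans ?_
    have := mul_le_mul hS hT (norm_nonneg _) hd
    nlinarith
  rw [e]
  have q1 := m1 _ _ hC hB
  have q2 := m1 _ _ hB hA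
  have q3 := m1 _ _ hC hA
  have q4 := m1 _ _ q1 hA
  have a1 := norm_add_le (A + B + C + C * B + B * A + C * A) (C * B * A)
  have a2 := norm_add_le (A + B + C + C * B + B * A) (C * A)
  have a3 := norm_add_le (A + B + C + C * B) (B * A)
  have a4 := norm_add_le (A + B + C) (C * B)
  have a5 := norm_add_le (A + B) C
  have a6 := norm_add_le A B
  linarith

theorem flat_const [FiniteDimensional ℝ V] {Φ : V → ℝ} {k : ℕ} {G : Submodule ℝ V → Prop}
    (h : IsMN Φ) (hk : 2 ≤ k) (F : Fam Φ k G) {X : Submodule ℝ V} (hX : G X)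
    {P1 : V →L[ℝ] V} (hP1 : Contr Φ X P1) {α β : V →L[ℝ] ℝ}
    (hα : ∀ v, α (P1 v) = α v) (hβ : ∀ v, β (P1 v) = β v) {e f : V} (he : e ∈ X) (hf : f ∈ X)
    (hαe : α e = 1) (hαf : α f = 0) (hβe : β e = 0) (hβf : β f = 1) (hflat : Flat Φ X α β)
    {y : V} (hy : P1 y = 0) :
    ∃ ρ : ℝ, 0 < ρ ∧ ∀ x ∈ X, ∀ t : ℝ, (|t| < ρ * |α x| ∨ |t| < ρ * |β x|) →
      Φ (x + t • y) = Φ x := by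
  obtain ⟨r, D, hr, hD, W, hW⟩ := transports h hk F hX hP1 hy
  obtain ⟨ε, hε, hfl⟩ := hflat
  have hαy : α y = 0 := by rw [← hα, hy, map_zero]
  have hβy : β y = 0 := by rw [← hβ, hy, map_zero]
  -- good functionals
  let S : (V →L[ℝ] ℝ) → Prop := fun l => (∀ v, l (P1 v) = l v) ∧
    (∀ v, α v = 0 → β v = 0 → l v = 0)
  obtain ⟨s, hs0, hsr, hsD, hsε⟩ : ∃ s : ℝ, 0 < s ∧ s ≤ r ∧ 2 * s * D ≤ 1 ∧
      7 * (2 * s * D) < ε := by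
    refine ⟨min r (min (1 / (2 * D)) (ε / (15 * D))), by positivity, min_le_left _ _, ?_, ?_⟩
    · have : min r (min (1 / (2 * D)) (ε / (15 * D))) ≤ 1 / (2 * D) :=
        (min_le_right _ _).trans (min_le_left _ _)
      rw [le_div_iff₀ (by positivity)] at this
      linarith
    · have : min r (min (1 / (2 * D)) (ε / (15 * D))) ≤ ε / (15 * D) :=
        (min_le_right _ _).trans (min_le_right _ _)
      rw [le_div_iff₀ (by positivity)] at this
      have : 0 < min r (min (1 / (2 * D)) (ε / (15 * D))) * D := by positivity
      nlinarith
  have hX0 : Xg X 0 y = X := by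
    ext v; rw [mem_Xg]; simp
  have hol : ∀ l l', S l → S l' → ‖l‖ < s → ‖l'‖ < s → ∀ x ∈ X,
      ((1 + (0 - l').smulRight (W l' 0)) * (1 + (l' - l).smulRight (W l l')) *
        (1 + (l - 0).smulRight (W 0 l)) : V →L[ℝ] V) x = x := by
    intro l l' hl hl' hls hls'
    have z1 : ∀ v, (0 : V →L[ℝ] ℝ) (P1 v) = (0 : V →L[ℝ] ℝ) v := by simp
    have z2 : ‖(0 : V →L[ℝ] ℝ)‖ < r := by simpa using hr
    have w1 := hW 0 l z1 hl.1 z2 (hls.trans_le hsr)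
    have w2 := hW l l' hl.1 hl'.1 (hls.trans_le hsr) (hls'.trans_le hsr)
    have w3 := hW l' 0 hl'.1 z1 (hls'.trans_le hsr) z2
    rw [hX0] at w1 w3
    refine hfl _ ?_ ?_ ?_ ?_
    · intro x hx
      exact (w3.2 _ (w2.2 _ (w1.2 x hx).1).1).1
    · intro x hx
      exact (w3.2 _ (w2.2 _ (w1.2 x hx).1).1).2.trans
        ((w2.2 _ (w1.2 x hx).1).2.trans (w1.2 x hx).2)
    · intro x hx h1 h2
      have := hl.2 x h1 h2
      have := hl'.2 x h1 h2
      simp [*]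
    · refine lt_of_le_of_lt (norm_prod3 (d := 2 * s * D) hsD ?_ ?_ ?_) hsε
      · rw [ContinuousLinearMap.norm_smulRight_apply]
        refine mul_le_mul ?_ w1.1 (norm_nonneg _) (by positivity)
        rw [sub_zero]; linarith
      · rw [ContinuousLinearMap.norm_smulRight_apply]
        refine mul_le_mul ?_ w2.1 (norm_nonneg _) (by positivity)
        refine (norm_sub_le _ _).trans ?_
        linarith
      · rw [ContinuousLinearMap.norm_smulRight_apply]
        refine mul_le_mul ?_ w3.1 (norm_nonneg _) (by positivity)
        rw [zero_sub, norm_neg]; linarith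
  -- B_l
  have hBm : ∀ l, S l → ‖l‖ < s → ∀ v ∈ Xg X l y, v - l v • W l 0 ∈ X ∧
      Φ (v - l v • W l 0) = Φ v := by
    intro l hl hls v hv
    have := (hW l 0 hl.1 (by simp) (hls.trans_le hsr) (by simpa using hr)).2 v hv
    rw [hX0] at this
    simpa [sub_eq_add_neg] using this
  have hAm : ∀ l, S l → ‖l‖ < s → ∀ v ∈ X, v + l v • W 0 l ∈ Xg X l y := by
    intro l hl hls v hv
    have := (hW 0 l (by simp) hl.1 (by simpa using hr) (hls.trans_le hsr)).2 v (by rwa [hX0])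
    simpa [sub_eq_add_neg] using this.1
  have hol' : ∀ l l', S l → S l' → ‖l‖ < s → ‖l'‖ < s → ∀ x ∈ X, ∀ v,
      v = x + l x • W 0 l → l v = l' v → v - l' v • W l' 0 = x := by
    intro l l' hl hl' hls hls' x hx v hv hll
    have := hol l l' hl hl' hls hls' x hx
    have e2 : (1 + (l - 0).smulRight (W 0 l) : V →L[ℝ] V) x = v := by simp [hv]
    rw [mul_assoc, mul_apply_eq_comp, mul_apply_eq_comp, e2] at this
    have e3 : (1 + (l' - l).smulRight (W l l') : V →L[ℝ] V) v = v := by simp [hll]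
    rw [e3] at this
    rw [← this]; simp [sub_eq_add_neg]
  have hBB : ∀ l l', S l → S l' → ‖l‖ < s → ‖l'‖ < s → ∀ v ∈ Xg X l y, l v = l' v →
      l v • W l 0 = l v • W l' 0 := by
    intro l l' hl hl' hls hls' v hv hll
    set x := v - l v • W l 0 with hx
    have hxX : x ∈ X := (hBm l hl hls v hv).1
    set v' := x + l x • W 0 l with hv'
    have hv'm : v' ∈ Xg X l y := hAm l hl hls x hxX
    have h1 := hol' l l hl hl hls hls x hxX v' hv' rfl
    have h2 : v' = v := by
      have h3 := (hBm l hl hls (v' - v) (Submodule.sub_mem _ hv'm hv)).2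
      have h4 : v' - v - l (v' - v) • W l 0 = 0 := by
        have : v' - v - l (v' - v) • W l 0 = (v' - l v' • W l 0) - (v - l v • W l 0) := by
          rw [map_sub]; module
        rw [this, h1, sub_self]
      rw [h4, h.zero] at h3
      exact sub_eq_zero.1 (h.eq_zero h3.symm)
    have h5 := hol' l l' hl hl' hls hls' x hxX v (by rw [← h2]) hll
    rw [hx, ← hll] at h5
    have := sub_right_injective h5
    exact this.symm
  have hSα : ∀ τ : ℝ, S (τ • α) := fun τ => ⟨fun v => by simp [hα], fun v h1 _ => by simp [h1]⟩
  have hSβ : ∀ τ : ℝ, S (τ • β) := fun τ => ⟨fun v => by simp [hβ], fun v _ h1 => by simp [h1]⟩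
  obtain ⟨ρ, hρ, hρα, hρβ⟩ : ∃ ρ : ℝ, 0 < ρ ∧ (∀ τ : ℝ, |τ| < ρ → ‖τ • α‖ < s) ∧
      (∀ τ : ℝ, |τ| < ρ → ‖τ • β‖ < s) := by
    refine ⟨s / (‖α‖ + ‖β‖ + 1), by positivity, fun τ hτ => ?_, fun τ hτ => ?_⟩ <;>
    · rw [lt_div_iff₀ (by positivity)] at hτ
      rw [norm_smul, Real.norm_eq_abs]
      have := abs_nonneg τ
      have := norm_nonneg α
      have := norm_nonneg β
      nlinarith [mul_nonneg (abs_nonneg τ) (norm_nonneg α), mul_nonneg (abs_nonneg τ) (norm_nonneg β)]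
  have hab : ∀ τ κ : ℝ, τ ≠ 0 → κ ≠ 0 → |τ| < ρ → |κ| < ρ → W (τ • α) 0 = W (κ • β) 0 := by
    intro τ κ h1 h2 h3 h4
    have hxX : τ⁻¹ • e + κ⁻¹ • f ∈ X := X.add_mem (X.smul_mem _ he) (X.smul_mem _ hf)
    have l1 : (τ • α) (τ⁻¹ • e + κ⁻¹ • f) = 1 := by simp [hαe, hαf, h1]
    have := hBB (τ • α) (κ • β) (hSα τ) (hSβ κ) (hρα _ h3) (hρβ _ h4)
      (τ⁻¹ • e + κ⁻¹ • f + y) (mem_Xg.2 ⟨_, hxX, by rw [l1, one_smul]⟩)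
      (by simp [hαe, hαf, hβe, hβf, hαy, hβy, h1, h2])
    have l2 : (τ • α) (τ⁻¹ • e + κ⁻¹ • f + y) = 1 := by simp [hαe, hαf, h1, hαy]
    rwa [l2, one_smul, one_smul] at this
  have hρ2 : |ρ / 2| < ρ := by rw [abs_of_pos (by positivity)]; linarith
  have hρn : ρ / 2 ≠ 0 := by positivity
  obtain ⟨w, hwdef⟩ : ∃ w, w = W ((ρ / 2) • α) 0 := ⟨_, rfl⟩
  have hwβ : ∀ κ : ℝ, κ ≠ 0 → |κ| < ρ → W (κ • β) 0 = w := fun κ h1 h2 =>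
    hwdef ▸ (hab _ _ hρn h1 hρ2 h2).symm
  have hwα : ∀ κ : ℝ, κ ≠ 0 → |κ| < ρ → W (κ • α) 0 = w := fun κ h1 h2 =>
    (hab _ _ h1 hρn h2 hρ2).trans (hwβ _ hρn hρ2)
  obtain ⟨u, hu⟩ : ∃ u, u = y - w := ⟨_, rfl⟩
  have hgen : ∀ γ : V →L[ℝ] ℝ, (∀ τ : ℝ, S (τ • γ)) → (∀ τ : ℝ, |τ| < ρ → ‖τ • γ‖ < s) →
      (∀ κ : ℝ, κ ≠ 0 → |κ| < ρ → W (κ • γ) 0 = w) → ∀ x ∈ X, ∀ t : ℝ, t ≠ 0 → |t| < ρ * |γ x| →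
      x + t • u ∈ X ∧ Φ (x + t • y) = Φ (x + t • u) := by
    intro γ hS hn hw x hx t ht0 ht
    have hγ0 : γ x ≠ 0 := by
      intro h0; rw [h0, abs_zero, mul_zero] at ht; exact absurd ht (abs_nonneg t).not_gt
    have hγy : γ y = 0 := by
      have := (hS 1).2 y hαy hβy; simpa using this
    have h1 : |t / γ x| < ρ := by
      rw [abs_div, div_lt_iff₀ (abs_pos.2 hγ0)]; exact ht
    have h2 : ((t / γ x) • γ) x = t := by simp [hγ0]
    have h3 : ((t / γ x) • γ) (x + t • y) = t := by
      rw [map_add, h2, map_smul]; simp [hγy]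
    have h4 := hBm _ (hS (t / γ x)) (hn _ h1) (x + t • y) (mem_Xg.2 ⟨x, hx, by rw [h2]⟩)
    rw [h3, hw _ (div_ne_zero ht0 hγ0) h1] at h4
    have h5 : x + t • y - t • w = x + t • u := by rw [hu]; module
    rw [h5] at h4
    exact ⟨h4.1, h4.2.symm⟩
  have hgα := hgen α hSα hρα hwα
  have hgβ := hgen β hSβ hρβ hwβ
  have huX : u ∈ X := by
    have h1 := (hgα e he (ρ / 2) hρn (by rw [hαe, abs_one, mul_one]; exact hρ2)).1
    have h2 := X.sub_mem h1 he
    rw [add_sub_cancel_left] at h2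
    have h3 := X.smul_mem (ρ / 2)⁻¹ h2
    rwa [smul_smul, inv_mul_cancel₀ hρn, one_smul] at h3
  have hc1 : ∀ x ∈ X, α x ≠ 0 → ∀ t : ℝ, Φ x ≤ Φ (x + t • (y - u)) := by
    intro x hx hx0
    have hev : ∀ᶠ t : ℝ in 𝓝 0, |t| < ρ * |α (x - t • u)| := by
      have hc : Continuous fun t : ℝ => ρ * |α (x - t • u)| - |t| := by fun_prop
      have h1 : ∀ᶠ t : ℝ in 𝓝 0, 0 < ρ * |α (x - t • u)| - |t| :=
        hc.continuousAt.eventually (lt_mem_nhds (by simp; positivity))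
      exact h1.mono fun t ht => by linarith
    obtain ⟨e1, he1, hev⟩ := Metric.eventually_nhds_iff.1 hev
    refine h.ge_of_local he1 fun t ht => ?_
    by_cases ht0 : t = 0
    · simp [ht0]
    have := (hgα (x - t • u) (X.sub_mem hx (X.smul_mem _ huX)) t ht0
      (hev (by simpa using ht))).2
    rw [sub_add_cancel] at this
    rw [← this]
    apply le_of_eq; congr 1; module
  have hc : ∀ x ∈ X, ∀ t : ℝ, Φ x ≤ Φ (x + t • (y - u)) := by
    intro x hx t
    have t1 : Tendsto (fun s : ℝ => Φ (x + s • e)) (𝓝[≠] 0) (𝓝 (Φ x)) := by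
      have : Continuous (fun s : ℝ => Φ (x + s • e)) := h.cont.comp (by fun_prop)
      have := this.tendsto 0
      simp at this
      exact this.mono_left nhdsWithin_le_nhds
    have t2 : Tendsto (fun s : ℝ => Φ (x + s • e + t • (y - u))) (𝓝[≠] 0)
        (𝓝 (Φ (x + t • (y - u)))) := by
      have : Continuous (fun s : ℝ => Φ (x + s • e + t • (y - u))) := h.cont.comp (by fun_prop)
      have := this.tendsto 0
      simp only [zero_smul, add_zero] at this
      exact this.mono_left nhdsWithin_le_nhds
    refine le_of_tendsto_of_tendsto t1 t2 ?_
    have hne : ∀ᶠ s : ℝ in 𝓝[≠] 0, α x + s ≠ 0 := by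
      by_cases h0 : α x = 0
      · filter_upwards [self_mem_nhdsWithin] with s hs
        simpa [h0] using hs
      · have hc : Continuous fun s : ℝ => α x + s := by fun_prop
        exact (hc.continuousAt.eventually_ne (by simpa using h0)).filter_mono nhdsWithin_le_nhds
    filter_upwards [hne] with s hs
    exact hc1 _ (X.add_mem hx (X.smul_mem _ he)) (by simpa [hαe] using hs) t
  have hu0 := uniq_aux h hk F hX hP1 hy huX hc
  refine ⟨ρ, hρ, fun x hx t ht => ?_⟩
  by_cases ht0 : t = 0
  · simp [ht0]
  rcases ht with ht | ht
  · rw [(hgα x hx t ht0 ht).2, hu0, smul_zero, add_zero]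
  · rw [(hgβ x hx t ht0 ht).2, hu0, smul_zero, add_zero]

end LBK

namespace LBK
open Filter Topology
variable {E : Type*} [NormedAddCommGroup E] [NormedSpace ℝ E]

open MeasureTheory in
theorem exists_inv_form [FiniteDimensional ℝ E] {Φ : E → ℝ} (h : IsMN Φ) :
    ∃ q : E →ₗ[ℝ] E →ₗ[ℝ] ℝ, (∀ x y, q x y = q y x) ∧ (∀ x, x ≠ 0 → 0 < q x x) ∧
      ∀ g : E →L[ℝ] E, (∀ x, Φ (g x) = Φ x) → ∀ x y, q (g x) (g y) = q x y := by
  let _ : MeasurableSpace (E →L[ℝ] ℝ) := borel _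
  have _i : BorelSpace (E →L[ℝ] ℝ) := ⟨rfl⟩
  obtain ⟨m, hm, hl⟩ := h.low
  obtain ⟨M, hM, hu⟩ := h.up
  let μ : Measure (E →L[ℝ] ℝ) := Measure.addHaar
  set D : Set (E →L[ℝ] ℝ) := {f | ∀ v, f v ≤ Φ v} with hD
  have hDc : IsClosed D := by
    have : D = ⋂ v, {f | f v ≤ Φ v} := by ext f; simp [hD]
    rw [this]
    exact isClosed_iInter fun v => isClosed_le (by fun_prop) continuous_const
  have hDb : D ⊆ Metric.closedBall 0 M := by
    intro f hf
    rw [mem_closedBall_zero_iff]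
    refine ContinuousLinearMap.opNorm_le_bound _ hM.le fun v => ?_
    have h1 := (hf v).trans (hu v)
    have h2 := (hf (-v)).trans (hu (-v))
    rw [map_neg, norm_neg] at h2
    rw [Real.norm_eq_abs, abs_le]; constructor <;> linarith
  have hDk : IsCompact D := (isCompact_closedBall _ _).of_isClosed_subset hDc hDb
  have hDball : Metric.ball (0 : E →L[ℝ] ℝ) m ⊆ D := by
    intro f hf v
    rw [mem_ball_zero_iff] at hf
    have := f.le_opNorm v
    have h1 : f v ≤ ‖f‖ * ‖v‖ := (le_abs_self _).trans this
    have h2 : ‖f‖ * ‖v‖ ≤ m * ‖v‖ := by gcongr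
    exact h1.trans (h2.trans (hl v))
  have hD0 : 0 < μ D := lt_of_lt_of_le (Metric.measure_ball_pos μ 0 hm) (measure_mono hDball)
  have hDt : μ D < ⊤ := hDk.measure_lt_top
  have hint : ∀ x y : E, IntegrableOn (fun f : E →L[ℝ] ℝ => f x * f y) D μ := fun x y =>
    ContinuousOn.integrableOn_compact hDk (by fun_prop)
  let q : E →ₗ[ℝ] E →ₗ[ℝ] ℝ := LinearMap.mk₂ ℝ (fun x y => ∫ f in D, f x * f y ∂μ)
    (fun x x' y => by
      rw [← integral_add (hint x y) (hint x' y)]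
      congr 1; ext f; simp; ring)
    (fun c x y => by
      rw [smul_eq_mul, ← integral_const_mul]
      congr 1; ext f; simp; ring)
    (fun x y y' => by
      rw [← integral_add (hint x y) (hint x y')]
      congr 1; ext f; simp; ring)
    (fun c x y => by
      rw [smul_eq_mul, ← integral_const_mul]
      congr 1; ext f; simp; ring)
  have hq : ∀ x y, q x y = ∫ f in D, f x * f y ∂μ := fun x y => rfl
  refine ⟨q, fun x y => ?_, fun x hx => ?_, fun g hg x y => ?_⟩
  · simp only [hq, mul_comm]
  · rw [hq, setIntegral_pos_iff_support_of_nonneg_ae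
      (Eventually.of_forall fun f => mul_self_nonneg _) (hint x x)]
    have hop : IsOpen ((Function.support fun f : E →L[ℝ] ℝ => f x * f x) ∩ Metric.ball 0 m) := by
      refine IsOpen.inter ?_ Metric.isOpen_ball
      exact (by fun_prop : Continuous fun f : E →L[ℝ] ℝ => f x * f x).isOpen_support
    refine lt_of_lt_of_le (hop.measure_pos μ ?_) (measure_mono (inter_subset_inter_right _ hDball))
    obtain ⟨f, hf1, hf2⟩ := exists_dual_vector ℝ x (norm_ne_zero_iff.2 hx)
    refine ⟨(m / 2) • f, ?_, ?_⟩
    · simp [hf2, hx, hm.ne']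
    · rw [mem_ball_zero_iff, norm_smul, hf1, Real.norm_eq_abs, abs_of_pos (by positivity)]
      linarith
  · have hinj : Function.Injective (g : E →ₗ[ℝ] E) := by
      rw [injective_iff_map_eq_zero]
      intro a ha
      apply h.eq_zero
      rw [← hg a]
      have : g a = 0 := ha
      rw [this, h.zero]
    have hsurj : Function.Surjective g := LinearMap.injective_iff_surjective.1 hinj
    let gs : (E →L[ℝ] ℝ) →L[ℝ] (E →L[ℝ] ℝ) := (ContinuousLinearMap.compL ℝ E E ℝ).flip g
    have hgs : ∀ f v, gs f v = f (g v) := fun f v => rfl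
    have hgsinj : Function.Injective gs := by
      intro f f' hff
      ext v
      obtain ⟨w, rfl⟩ := hsurj v
      rw [← hgs, hff, hgs]
    have hpre : gs ⁻¹' D = D := by
      ext f
      simp only [mem_preimage, hD, mem_setOf_eq, hgs]
      constructor
      · intro hf v
        obtain ⟨w, rfl⟩ := hsurj v
        rw [hg]; exact hf w
      · intro hf v
        rw [← hg]; exact hf _
    have hdet : LinearMap.det (gs : (E →L[ℝ] ℝ) →ₗ[ℝ] (E →L[ℝ] ℝ)) ≠ 0 := by
      have := LinearEquiv.isUnit_det' (LinearEquiv.ofInjectiveEndo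
        (gs : (E →L[ℝ] ℝ) →ₗ[ℝ] (E →L[ℝ] ℝ)) hgsinj)
      have e : ((LinearEquiv.ofInjectiveEndo
        (gs : (E →L[ℝ] ℝ) →ₗ[ℝ] (E →L[ℝ] ℝ)) hgsinj) : (E →L[ℝ] ℝ) →ₗ[ℝ] (E →L[ℝ] ℝ)) = gs := by
        ext; rfl
      rw [e] at this
      exact this.ne_zero
    have hmap := Measure.map_linearMap_addHaar_eq_smul_addHaar μ hdet
    have hemb : MeasurableEmbedding gs :=
      (LinearMap.isClosedEmbedding_of_injective (f := (gs : (E →L[ℝ] ℝ) →ₗ[ℝ] (E →L[ℝ] ℝ)))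
        (LinearMap.ker_eq_bot.2 hgsinj)).measurableEmbedding
    set c := ENNReal.ofReal |(LinearMap.det (gs : (E →L[ℝ] ℝ) →ₗ[ℝ] (E →L[ℝ] ℝ)))⁻¹| with hc
    have hc1 : c = 1 := by
      have e1 : (Measure.map gs μ) D = c * μ D := by
        have : Measure.map gs μ = c • μ := hmap
        rw [this]; simp
      rw [hemb.map_apply, hpre] at e1
      have e2 : (1 : ENNReal) * μ D = c * μ D := by rw [one_mul]; exact e1
      exact ((ENNReal.mul_left_inj hD0.ne' hDt.ne).1 e2).symm
    have hmp : MeasurePreserving gs μ μ := ⟨hemb.measurable, by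
      have : Measure.map gs μ = c • μ := hmap
      rw [this, hc1, one_smul]⟩
    have := hmp.setIntegral_preimage_emb hemb (fun f : E →L[ℝ] ℝ => f x * f y) D
    rw [hpre] at this
    rw [hq, hq, ← this]
    rfl

end LBK

namespace LBK
open Filter Topology
variable {E : Type*} [NormedAddCommGroup E] [NormedSpace ℝ E]

theorem circle [FiniteDimensional ℝ E] {Φ : E → ℝ} (h : IsMN Φ) {q : E →ₗ[ℝ] E →ₗ[ℝ] ℝ}
    (hqs : ∀ x y, q x y = q y x) (hqp : ∀ x, x ≠ 0 → 0 < q x x)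
    (hqi : ∀ g : E →L[ℝ] E, (∀ x, Φ (g x) = Φ x) → ∀ x y, q (g x) (g y) = q x y)
    {u u' : E} (h1 : q u u = 1) (h2 : q u' u' = 1) (h3 : q u u' = 0)
    (hnf : ∀ ε : ℝ, 0 < ε → ∃ g : E →L[ℝ] E, (∀ x, Φ (g x) = Φ x) ∧
      (∀ z, q u z = 0 → q u' z = 0 → g z = z) ∧ ‖g - 1‖ < ε ∧ ∃ x, g x ≠ x) (θ : ℝ) :
    Φ (Real.cos θ • u + Real.sin θ • u') = Φ u := by
  set φ : ℝ → ℝ := fun s => Φ (Real.cos s • u + Real.sin s • u') with hφ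
  have hφc : Continuous φ := h.cont.comp (by fun_prop)
  let H : AddSubgroup ℝ :=
    { carrier := {θ | ∀ s, φ (s + θ) = φ s}
      add_mem' := fun {a b} ha hb s => by
        have := hb (s + a)
        rw [← add_assoc, this, ha]
      zero_mem' := fun s => by simp
      neg_mem' := fun {a} ha s => by
        have := ha (s + -a)
        rw [← this]; congr 1; ring }
  have hH : ∀ θ, θ ∈ H ↔ ∀ s, φ (s + θ) = φ s := fun θ => Iff.rfl
  have h3' : q u' u = 0 := by rw [hqs, h3]
  have hfr : ∃ᶠ g : E →L[ℝ] E in 𝓝 1, (∀ x, Φ (g x) = Φ x) ∧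
      (∀ z, q u z = 0 → q u' z = 0 → g z = z) ∧ ∃ x, g x ≠ x := by
    rw [Metric.nhds_basis_ball.frequently_iff]
    intro ε hε
    obtain ⟨g, a, b, c, d⟩ := hnf ε hε
    exact ⟨g, by rw [Metric.mem_ball, dist_eq_norm]; exact c, a, b, d⟩
  have hcont : ∀ x y : E, Continuous fun g : E →L[ℝ] E => q x (g y) := fun x y =>
    (LinearMap.continuous_of_finiteDimensional (q x)).comp (by fun_prop)
  have key : ∀ ε : ℝ, 0 < ε → ∃ θ ∈ H, θ ∈ Ioo 0 ε := by
    intro ε hε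
    suffices hs : ∃ θ ∈ H, θ ≠ 0 ∧ |θ| < ε by
      obtain ⟨θ, ha, hb, hc⟩ := hs
      rcases lt_or_gt_of_ne hb with hb | hb
      · exact ⟨-θ, H.neg_mem ha, by linarith, by rwa [abs_of_neg hb] at hc⟩
      · exact ⟨θ, ha, hb, by rwa [abs_of_pos hb] at hc⟩
    have ev1 : ∀ᶠ g : E →L[ℝ] E in 𝓝 1, 0 < q u (g u) :=
      (hcont u u).continuousAt.eventually (lt_mem_nhds (by simp [h1]))
    have ev2 : ∀ᶠ g : E →L[ℝ] E in 𝓝 1,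
        0 < q u (g u) * q u' (g u') - q u' (g u) * q u (g u') :=
      (((hcont u u).mul (hcont u' u')).sub ((hcont u' u).mul (hcont u u'))).continuousAt.eventually
        (lt_mem_nhds (by simp [h1, h2, h3]))
    have ev3 : ∀ᶠ g : E →L[ℝ] E in 𝓝 1, |Real.arcsin (q u' (g u))| < ε := by
      have : Continuous fun g : E →L[ℝ] E => |Real.arcsin (q u' (g u))| :=
        (Real.continuous_arcsin.comp (hcont u' u)).abs
      exact this.continuousAt.eventually (gt_mem_nhds (by simp [h3', hε]))
    obtain ⟨g, ⟨gi, gz, x0, hx0⟩, e1, e2, e3⟩ := (hfr.and_eventually (ev1.and (ev2.and ev3))).exists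
    have gq := hqi g gi
    have dec : ∀ p : E, (∀ z, q u z = 0 → q u' z = 0 → q z p = 0) →
        g p = q u (g p) • u + q u' (g p) • u' := by
      intro p hp
      set z := g p - (q u (g p) • u + q u' (g p) • u') with hz
      have z1 : q u z = 0 := by simp [hz, h1, h3]
      have z2 : q u' z = 0 := by simp [hz, h2, h3']
      have z3 : q z (g p) = 0 := by
        nth_rewrite 1 [← gz z z1 z2]
        rw [gq, hp z z1 z2]
      have z4 : q z z = 0 := by
        nth_rewrite 2 [hz]
        simp [z3, hqs z u, hqs z u', z1, z2]
      by_contra hne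
      exact (hqp z (sub_ne_zero.2 hne)).ne' z4
    have d1 := dec u (fun z a b => by rw [hqs, a])
    have d2 := dec u' (fun z a b => by rw [hqs, b])
    set a := q u (g u)
    set b := q u' (g u)
    set c := q u (g u')
    set d := q u' (g u')
    have r1 : a * a + b * b = 1 := by
      have := gq u u
      rw [d1] at this
      simp [h1, h2, h3, h3'] at this
      exact this
    have r2 : c * c + d * d = 1 := by
      have := gq u' u'
      rw [d2] at this
      simp [h1, h2, h3, h3'] at this
      exact this
    have r3 : a * c + b * d = 0 := by
      have := gq u u'
      rw [d1, d2] at this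
      simp [h1, h2, h3, h3'] at this
      linarith
    have r4 : a * d - b * c = 1 := by
      have : (a * d - b * c) ^ 2 = 1 := by
        have : (a * d - b * c) ^ 2 = (a * a + b * b) * (c * c + d * d) - (a * c + b * d) ^ 2 := by
          ring
        rw [this, r1, r2, r3]; norm_num
      nlinarith
    have r5 : d = a := by
      have : d = d * (a * a + b * b) := by rw [r1, mul_one]
      have h' : d * (a * a + b * b) = a * (a * d - b * c) + b * (a * c + b * d) := by ring
      rw [this, h', r4, r3]; ring
    have r6 : c = -b := by
      have : c = c * (a * a + b * b) := by rw [r1, mul_one]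
      have h' : c * (a * a + b * b) = a * (a * c + b * d) - b * (a * d - b * c) := by ring
      rw [this, h', r4, r3]; ring
    have hb1 : -1 ≤ b := by nlinarith
    have hb2 : b ≤ 1 := by nlinarith
    have hsin : Real.sin (Real.arcsin b) = b := Real.sin_arcsin hb1 hb2
    have hcos : Real.cos (Real.arcsin b) = a := by
      rw [Real.cos_arcsin, show 1 - b ^ 2 = a ^ 2 by linarith, Real.sqrt_sq e1.le]
    refine ⟨Real.arcsin b, ?_, ?_, e3⟩
    · rw [hH]
      intro s
      simp only [hφ]
      rw [← gi (Real.cos s • u + Real.sin s • u'), map_add, map_smul, map_smul, d1, d2, r5, r6,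
        Real.cos_add, Real.sin_add, hsin, hcos]
      congr 1; module
    · intro h0
      rw [h0, Real.sin_zero] at hsin
      rw [h0, Real.cos_zero] at hcos
      apply hx0
      have g1 : g u = u := by rw [d1, ← hsin, ← hcos]; simp
      have g2 : g u' = u' := by rw [d2, r5, r6, ← hsin, ← hcos]; simp
      have g3 := gz (x0 - q u x0 • u - q u' x0 • u') (by simp [h1, h3]) (by simp [h2, h3'])
      simp only [map_sub, map_smul, g1, g2] at g3
      have := sub_left_injective (sub_left_injective g3)
      exact this
  have hdense : Dense (H : Set ℝ) := AddSubgroup.dense_of_not_isolated_zero H key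
  have : φ = fun _ => φ 0 := Continuous.ext_on hdense hφc continuous_const (fun θ hθ => by
    have := (hH θ).1 hθ 0
    rwa [zero_add] at this)
  have := congrFun this θ
  simpa [hφ] using this

theorem exists_flat [FiniteDimensional ℝ E] {Φ : E → ℝ} (h : IsMN Φ) (hE : 2 ≤ finrank ℝ E)
    (hpar : ¬ ∀ x y, Φ (x + y) ^ 2 + Φ (x - y) ^ 2 = 2 * Φ x ^ 2 + 2 * Φ y ^ 2)
    {x0 : E} (hx0 : x0 ≠ 0) :
    ∃ (u u' : E) (α β : E →L[ℝ] ℝ), α u = 1 ∧ α u' = 0 ∧ β u = 0 ∧ β u' = 1 ∧ α x0 ≠ 0 ∧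
      ∃ ε : ℝ, 0 < ε ∧ ∀ g : E →L[ℝ] E, (∀ x, Φ (g x) = Φ x) →
        (∀ z, α z = 0 → β z = 0 → g z = z) → ‖g - 1‖ < ε → ∀ x, g x = x := by
  obtain ⟨q, hqs, hqp, hqi⟩ := exists_inv_form h
  have hx0p := hqp x0 hx0
  have hsp : 0 < Real.sqrt (q x0 x0) := Real.sqrt_pos.2 hx0p
  have hunit : ∀ w : E, w ≠ 0 → q ((Real.sqrt (q w w))⁻¹ • w) ((Real.sqrt (q w w))⁻¹ • w) = 1 := by
    intro w hw
    have := hqp w hw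
    have e := Real.mul_self_sqrt this.le
    have hs := Real.sqrt_pos.2 this
    simp only [map_smul, LinearMap.smul_apply, smul_eq_mul]
    nth_rewrite 3 [← e]
    field_simp
  obtain ⟨u, hu⟩ : ∃ u, u = (Real.sqrt (q x0 x0))⁻¹ • x0 := ⟨_, rfl⟩
  have h1 : q u u = 1 := by rw [hu]; exact hunit x0 hx0
  by_contra hcon
  push Not at hcon
  have hcirc : ∀ u', q u' u' = 1 → q u u' = 0 → ∀ θ : ℝ,
      Φ (Real.cos θ • u + Real.sin θ • u') = Φ u := by
    intro u' h2 h3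
    refine circle h hqs hqp hqi h1 h2 h3 fun ε hε => ?_
    obtain ⟨g, a, b, c, d⟩ := hcon u u' (LinearMap.toContinuousLinearMap (q u))
      (LinearMap.toContinuousLinearMap (q u')) (by simpa using h1) (by simpa using h3)
      (by simpa [hqs u' u] using h3) (by simpa using h2)
      (by simp [hu, hx0p.ne', hsp.ne']) ε hε
    exact ⟨g, a, by simpa using b, c, d⟩
  have hsm : ∀ w : E, w ≠ 0 → q u w = 0 → ∃ u', q u' u' = 1 ∧ q u u' = 0 ∧ ∃ b : ℝ, w = b • u' := by
    intro w hw hw0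
    refine ⟨(Real.sqrt (q w w))⁻¹ • w, hunit w hw, by simp [hw0], Real.sqrt (q w w), ?_⟩
    rw [smul_smul, mul_inv_cancel₀ (Real.sqrt_pos.2 (hqp w hw)).ne', one_smul]
  have hdec : ∀ v : E, ∃ u', q u' u' = 1 ∧ q u u' = 0 ∧ ∃ a b : ℝ, v = a • u + b • u' := by
    intro v
    by_cases hw : v - q u v • u = 0
    · obtain ⟨x, hx⟩ : ∃ x, x ∉ Submodule.span ℝ {u} := by
        by_contra hall
        push Not at hall
        have e : Submodule.span ℝ {u} = ⊤ := by rw [eq_top_iff]; intro x _; exact hall x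
        have := finrank_span_le_card (R := ℝ) ({u} : Set E)
        rw [e] at this
        simp at this
        omega
      obtain ⟨u', a, b, -⟩ := hsm (x - q u x • u) (by
        intro h0
        apply hx
        rw [sub_eq_zero.1 h0]
        exact Submodule.smul_mem _ _ (Submodule.mem_span_singleton_self u)) (by simp [h1])
      exact ⟨u', a, b, q u v, 0, by rw [zero_smul, add_zero]; exact sub_eq_zero.1 hw⟩
    · obtain ⟨u', a, b, t, ht⟩ := hsm _ hw (by simp [h1])
      exact ⟨u', a, b, q u v, t, by rw [← ht]; abel⟩
  have hfin : ∀ v, Φ v ^ 2 = Φ u ^ 2 * q v v := by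
    intro v
    obtain ⟨u', a, b, s, t, rfl⟩ := hdec v
    have e1 : q (s • u + t • u') (s • u + t • u') = s ^ 2 + t ^ 2 := by
      simp [h1, a, b, hqs u' u]; ring
    have e2 := Complex.norm_mul_cos_arg (⟨s, t⟩ : ℂ)
    have e3 := Complex.norm_mul_sin_arg (⟨s, t⟩ : ℂ)
    have e5 : ‖(⟨s, t⟩ : ℂ)‖ ^ 2 = s ^ 2 + t ^ 2 := by
      rw [← Complex.normSq_eq_norm_sq, Complex.normSq_mk]; ring
    simp only at e2 e3
    set R := ‖(⟨s, t⟩ : ℂ)‖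
    set θ := Complex.arg ⟨s, t⟩
    have e4 : s • u + t • u' = R • (Real.cos θ • u + Real.sin θ • u') := by
      rw [← e2, ← e3]; module
    rw [e1, e4, h.hom _ _ (norm_nonneg _), hcirc u' a b, mul_pow, e5]; ring
  apply hpar
  intro x y
  rw [hfin (x + y), hfin (x - y), hfin x, hfin y]
  simp; ring

end LBK

namespace LBK
open Filter Topology
variable {V : Type*} [NormedAddCommGroup V] [NormedSpace ℝ V]

/-- parallelogram law on `X` -/
def Par (Φ : V → ℝ) (X : Submodule ℝ V) : Prop :=
  ∀ x ∈ X, ∀ y ∈ X, Φ (x + y) ^ 2 + Φ (x - y) ^ 2 = 2 * Φ x ^ 2 + 2 * Φ y ^ 2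

theorem exists_flatV [FiniteDimensional ℝ V] {Φ : V → ℝ} {X : Submodule ℝ V}
    (h : IsMN Φ) (hX : 2 ≤ finrank ℝ X) {P1 : V →L[ℝ] V} (hP1 : Contr Φ X P1)
    (hpar : ¬ Par Φ X) {x0 : V} (hx0X : x0 ∈ X) (hx0 : x0 ≠ 0) :
    ∃ (e f : V) (α β : V →L[ℝ] ℝ), e ∈ X ∧ f ∈ X ∧ (∀ v, α (P1 v) = α v) ∧
      (∀ v, β (P1 v) = β v) ∧ α e = 1 ∧ α f = 0 ∧ β e = 0 ∧ β f = 1 ∧ α x0 ≠ 0 ∧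
      Flat Φ X α β := by
  have hE : IsMN (fun x : X => Φ x) :=
    ⟨fun c v hc => h.hom c v hc, fun v w => h.sub v w,
      let ⟨m, hm, hl⟩ := h.low; ⟨m, hm, fun v => hl v⟩,
      let ⟨m, hm, hl⟩ := h.up; ⟨m, hm, fun v => hl v⟩⟩
  obtain ⟨u, u', α, β, a1, a2, a3, a4, a5, ε, hε, hfl⟩ := exists_flat hE hX (by
    intro hall
    exact hpar fun x hx y hy => hall ⟨x, hx⟩ ⟨y, hy⟩) (x0 := ⟨x0, hx0X⟩)
      (by simpa [← Submodule.coe_eq_zero] using hx0)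
  let R : V →L[ℝ] X := P1.codRestrict X hP1.mem
  have hR : ∀ x : X, R x = x := fun x => by
    apply Subtype.ext; simp [R, hP1.fix x x.2]
  have hRP : ∀ v, R (P1 v) = R v := fun v => by
    apply Subtype.ext; simp [R, hP1.fix _ (hP1.mem v)]
  refine ⟨u, u', α.comp R, β.comp R, u.2, u'.2, fun v => by simp [hRP], fun v => by simp [hRP],
    by simp [hR, a1], by simp [hR, a2], by simp [hR, a3], by simp [hR, a4], ?_, ε, hε, ?_⟩
  · have := hR ⟨x0, hx0X⟩
    simp only at this
    simp [this, a5]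
  · intro g g1 g2 g3 g4 x hx
    let gX : X →L[ℝ] X := (g.comp X.subtypeL).codRestrict X (fun x => g1 x x.2)
    have := hfl gX (fun x => g2 x x.2) (fun z z1 z2 => by
      apply Subtype.ext
      exact g3 z z.2 (by simp [hR, z1]) (by simp [hR, z2])) (by
        refine lt_of_le_of_lt (ContinuousLinearMap.opNorm_le_bound _ (norm_nonneg (g - 1)) ?_) g4
        intro x
        exact (g - 1).le_opNorm (x : V)) ⟨x, hx⟩
    exact congrArg Subtype.val this

theorem nonpar_ray [FiniteDimensional ℝ V] {Φ : V → ℝ} {k : ℕ} {G : Submodule ℝ V → Prop}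
    (h : IsMN Φ) (hk : 2 ≤ k) (F : Fam Φ k G) {X : Submodule ℝ V} (hX : G X)
    {P1 : V →L[ℝ] V} (hP1 : Contr Φ X P1) (hpar : ¬ Par Φ X) {y : V} (hy : P1 y = 0) :
    ∃ ε : ℝ, 0 < ε ∧ ∀ x ∈ X, ∀ t : ℝ, |t| < ε * ‖x‖ → Φ (x + t • y) = Φ x := by
  have hcl : IsClosed (X : Set V) := X.closed_of_finiteDimensional
  have hK : IsCompact ((X : Set V) ∩ Metric.sphere 0 1) := (isCompact_sphere 0 1).inter_left hcl
  have hmain : ∃ ε : ℝ, 0 < ε ∧ ∀ x ∈ (X : Set V) ∩ Metric.sphere 0 1, ∀ t : ℝ, |t| < ε →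
      Φ (x + t • y) = Φ x := by
    refine hK.induction_on (p := fun s => ∃ ε : ℝ, 0 < ε ∧ ∀ x ∈ s, ∀ t : ℝ, |t| < ε →
      Φ (x + t • y) = Φ x) ⟨1, one_pos, by simp⟩ ?_ ?_ ?_
    · rintro s s' hs ⟨ε, hε, H⟩
      exact ⟨ε, hε, fun x hx => H x (hs hx)⟩
    · rintro s s' ⟨ε, hε, H⟩ ⟨ε', hε', H'⟩
      refine ⟨min ε ε', by positivity, ?_⟩
      rintro x (hx | hx) t ht
      · exact H x hx t (ht.trans_le (min_le_left _ _))
      · exact H' x hx t (ht.trans_le (min_le_right _ _))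
    · rintro x0 ⟨hx0, hn⟩
      have hne : x0 ≠ 0 := by rintro rfl; simp at hn
      obtain ⟨e, f, α, β, he, hf, hα, hβ, a1, a2, a3, a4, a5, hfl⟩ :=
        exists_flatV h (by rw [F.rank X hX]; exact hk) hP1 hpar hx0 hne
      obtain ⟨ρ, hρ, H⟩ := flat_const h hk F hX hP1 hα hβ he hf a1 a2 a3 a4 hfl hy
      have hpos : 0 < |α x0| := abs_pos.2 a5
      refine ⟨{x | x ∈ X ∧ |α x0| / 2 < |α x|}, ?_, ρ * (|α x0| / 2), by positivity, ?_⟩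
      · have hc : Continuous fun x => |α x| := by fun_prop
        have h1 : ∀ᶠ x in 𝓝 x0, |α x0| / 2 < |α x| :=
          hc.continuousAt.eventually (lt_mem_nhds (by linarith))
        filter_upwards [nhdsWithin_le_nhds h1, self_mem_nhdsWithin] with x hx hx'
        exact ⟨hx'.1, hx⟩
      · rintro x ⟨hx, hx'⟩ t ht
        refine H x hx t (Or.inl (ht.trans ?_))
        gcongr
  obtain ⟨ε, hε, H⟩ := hmain
  refine ⟨ε, hε, fun x hx t ht => ?_⟩
  have hx0 : 0 < ‖x‖ := by
    by_contra h0
    have : ‖x‖ = 0 := le_antisymm (not_lt.1 h0) (norm_nonneg x)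
    rw [this, mul_zero] at ht
    exact absurd ht (abs_nonneg t).not_gt
  have h1 := H (‖x‖⁻¹ • x) ⟨X.smul_mem _ hx, by simp [norm_smul, hx0.ne']⟩ (t / ‖x‖) (by
    rw [abs_div, abs_of_pos hx0, div_lt_iff₀ hx0]; exact ht)
  have e1 : x + t • y = ‖x‖ • (‖x‖⁻¹ • x + (t / ‖x‖) • y) := by
    rw [smul_add, smul_smul, smul_smul, mul_inv_cancel₀ hx0.ne', one_smul, mul_div_cancel₀ _ hx0.ne']
  have e2 : x = ‖x‖ • (‖x‖⁻¹ • x) := by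
    rw [smul_smul, mul_inv_cancel₀ hx0.ne', one_smul]
  rw [e1, h.hom _ _ hx0.le, h1, ← h.hom _ _ hx0.le, ← e2]

theorem Fam.nonpar [FiniteDimensional ℝ V] {Φ : V → ℝ} {k : ℕ} {G : Submodule ℝ V → Prop}
    (h : IsMN Φ) (F : Fam Φ k G) : Fam Φ k (fun X => G X ∧ ¬ Par Φ X) := by
  refine ⟨fun X hX => F.rank X hX.1, fun X hX => F.contr X hX.1, fun X hX => ?_⟩
  refine (F.opn X hX.1).and ?_
  have hn := hX.2
  unfold Par at hn
  push Not at hn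
  obtain ⟨x, hx, y, hy, hne⟩ := hn
  have hc : Continuous fun T : V →L[ℝ] V => Φ (T x + T y) ^ 2 + Φ (T x - T y) ^ 2 -
      (2 * Φ (T x) ^ 2 + 2 * Φ (T y) ^ 2) := by
    have := h.cont
    fun_prop
  have hev := hc.continuousAt.eventually_ne (x := 1) (y := 0) (by simpa [sub_eq_zero] using hne)
  filter_upwards [hev] with T hT hP
  exact hT (sub_eq_zero.2 (hP (T x) ⟨x, hx, rfl⟩ (T y) ⟨y, hy, rfl⟩))

theorem nonpar_unif [FiniteDimensional ℝ V] {Φ : V → ℝ} {k : ℕ} {G : Submodule ℝ V → Prop}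
    (h : IsMN Φ) (hk : 2 ≤ k) (F : Fam Φ k G) {X : Submodule ℝ V} (hX : G X)
    {P1 : V →L[ℝ] V} (hP1 : Contr Φ X P1) (hpar : ¬ Par Φ X) :
    ∃ δ : ℝ, 0 < δ ∧ ∀ x ∈ X, ∀ y, P1 y = 0 → ‖y‖ ≤ δ * ‖x‖ → Φ (x + y) = Φ x := by
  have F' := F.nonpar h
  obtain ⟨e, he, hop⟩ := Metric.eventually_nhds_iff.1 (F'.opn X ⟨hX, hpar⟩)
  refine ⟨e / (‖P1‖ + 1), by positivity, fun x hx y hy hyx => ?_⟩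
  by_cases hx0 : x = 0
  · have : y = 0 := by simpa [hx0] using hyx
    simp [this]
  have hxp : 0 < ‖x‖ := norm_pos_iff.2 hx0
  obtain ⟨f, hf1, hf2⟩ := exists_dual_vector ℝ x hxp.ne'
  let lam : V →L[ℝ] ℝ := ‖x‖⁻¹ • f.comp P1
  have hlx : lam x = 1 := by
    simp [lam, hP1.fix x hx, hf2, hxp.ne']
  have hlP : ∀ v, lam (P1 v) = lam v := fun v => by simp [lam, hP1.fix _ (hP1.mem v)]
  have hly : lam y = 0 := by rw [← hlP, hy, map_zero]
  have hln : ‖lam‖ * ‖y‖ < e := by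
    have h1 : ‖lam‖ ≤ ‖x‖⁻¹ * ‖P1‖ := by
      simp only [lam]
      rw [norm_smul, norm_inv, norm_norm]
      gcongr
      refine (f.opNorm_comp_le P1).trans ?_
      rw [hf1, one_mul]
    calc ‖lam‖ * ‖y‖ ≤ (‖x‖⁻¹ * ‖P1‖) * (e / (‖P1‖ + 1) * ‖x‖) := by gcongr
      _ = e * (‖P1‖ / (‖P1‖ + 1)) := by field_simp
      _ < e * 1 := by
        gcongr
        rw [div_lt_one (by positivity)]; linarith
      _ = e := mul_one e
  let cl : ℝ → ℝ := fun t => (projIcc (0:ℝ) 1 zero_le_one t : ℝ)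
  have hclc : Continuous cl := continuous_subtype_val.comp continuous_projIcc
  have hcl : ∀ t ∈ Icc (0:ℝ) 1, cl t = t := fun t ht => by
    simp [cl, projIcc_of_mem zero_le_one ht]
  have hG : ∀ t, G (Xg X (cl t • lam) y) ∧ ¬ Par Φ (Xg X (cl t • lam) y) := by
    intro t
    refine hop ?_
    rw [dist_eq_norm, add_sub_cancel_left, ContinuousLinearMap.norm_smulRight_apply, norm_smul,
      Real.norm_eq_abs]
    have hmem : cl t ∈ Icc (0:ℝ) 1 := (projIcc (0:ℝ) 1 zero_le_one t).2
    rw [abs_of_nonneg hmem.1]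
    calc cl t * ‖lam‖ * ‖y‖ ≤ 1 * ‖lam‖ * ‖y‖ := by gcongr; exact hmem.2
      _ < e := by rwa [one_mul]
  choose P hP using fun t => F.contr _ (hG t).1
  have hPc : Continuous P := by
    rw [continuous_iff_continuousAt]
    intro t0
    refine tendsto_proj h hk F (T := fun t => 1 + (cl t • lam).smulRight y)
      (T0 := 1 + (cl t0 • lam).smulRight y) (X := X) ?_ ?_ ?_ (hP t0)
    · have : Continuous (fun t => 1 + (cl t • lam).smulRight y) := by
        have h1 : Continuous (fun t => (ContinuousLinearMap.smulRightL ℝ V V (cl t • lam)) y) := by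
          fun_prop
        exact continuous_const.add h1
      exact this.tendsto t0
    · exact Eventually.of_forall fun t => ⟨hP t, F.rank _ (hG t).1⟩
    · exact (hG t0).1
  have hI : Icc (0:ℝ) 1 ⊆ {t | P t y = 0} := by
    refine IsClosed.Icc_subset_of_forall_mem_nhdsWithin ?_ ?_ ?_
    · refine IsClosed.inter ?_ isClosed_Icc
      exact isClosed_eq (by fun_prop) continuous_const
    · have hX0 : Xg X (cl 0 • lam) y = X := by
        rw [hcl 0 (left_mem_Icc.2 zero_le_one)]
        ext v; rw [mem_Xg]; simp
      have := hP 0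
      rw [hX0] at this
      show P 0 y = 0
      rw [uniq h hk F hX hP1 this, hy]
    · rintro t ⟨ht, ht0, ht1⟩
      have ht : P t y = 0 := ht
      obtain ⟨ε, hε, H⟩ := nonpar_ray h hk F (hG t).1 (hP t) (hG t).2 ht
      have ev : ∀ᶠ t' in 𝓝[>] t, t' < 1 ∧ (t' - t) * ‖lam‖ < ε / 2 := by
        apply nhdsWithin_le_nhds
        have hc : Continuous fun t' => (t' - t) * ‖lam‖ := by fun_prop
        exact (gt_mem_nhds ht1).and (hc.continuousAt.eventually (gt_mem_nhds (by simp; positivity)))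
      filter_upwards [ev, self_mem_nhdsWithin] with t' ⟨ht'1, ht'2⟩ ht'3
      have ht'3 : t < t' := ht'3
      have c1 : cl t = t := hcl t ⟨ht0, ht1.le⟩
      have c2 : cl t' = t' := hcl t' ⟨by linarith, ht'1.le⟩
      have hu := uniq_aux h hk F (hG t').1 (hP t') (y := y - P t' y)
        (by rw [map_sub, (hP t').fix _ ((hP t').mem y), sub_self]) (u := - P t' y)
        (Submodule.neg_mem _ ((hP t').mem y)) ?_
      · exact neg_eq_zero.1 hu
      · intro z hz s
        have e0 : y - P t' y - -P t' y = y := by abel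
        rw [e0]
        rw [c2] at hz
        obtain ⟨x1, hx1, rfl⟩ := mem_Xg.1 hz
        simp only [smul_apply, smul_eq_mul]
        have hx' : x1 + (t * lam x1) • y ∈ Xg X (cl t • lam) y := by
          rw [c1]; exact mem_Xg.2 ⟨x1, hx1, by simp⟩
        set x' := x1 + (t * lam x1) • y with hx'd
        have hlx' : lam x' = lam x1 := by simp [hx'd, hly]
        by_cases hx'0 : x' = 0
        · have : lam x1 = 0 := by rw [← hlx', hx'0, map_zero]
          have h0 : x1 = 0 := by rw [hx'd, this] at hx'0; simpa using hx'0
          rw [this, h0]; simp [h.zero, h.nonneg]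
        have hnp : 0 < ‖x'‖ := norm_pos_iff.2 hx'0
        have hb : |(t' - t) * lam x'| < ε / 2 * ‖x'‖ := by
          rw [abs_mul, abs_of_pos (by linarith)]
          calc (t' - t) * |lam x'| ≤ (t' - t) * (‖lam‖ * ‖x'‖) := by
                have := lam.le_opNorm x'
                rw [Real.norm_eq_abs] at this
                have : 0 < t' - t := by linarith
                gcongr
            _ = ((t' - t) * ‖lam‖) * ‖x'‖ := by ring
            _ < _ := by gcongr
        have ez : x1 + (t' * lam x1) • y = x' + ((t' - t) * lam x') • y := by
          rw [hlx', hx'd]; module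
        rw [ez]
        refine h.ge_of_local (ε := ε / 2 * ‖x'‖) (by positivity) (fun s hs => ?_) s
        rw [H x' hx' _ (hb.trans (by nlinarith)), add_assoc, ← add_smul, H x' hx' _ ?_]
        refine (abs_add_le _ _).trans_lt ?_
        linarith
  have hxt : ∀ t ∈ Icc (0:ℝ) 1, ∀ s : ℝ, Φ (x + t • y) ≤ Φ (x + s • y) := by
    intro t ht s
    have h1 : P t (x + t • y) = x + t • y := (hP t).fix _ (by
      rw [hcl t ht]; exact mem_Xg.2 ⟨x, hx, by simp [hlx]⟩)
    have h2 : P t y = 0 := hI ht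
    have h3 : P t x = x + t • y := by simpa [h2] using h1
    have := (hP t).le (x + s • y)
    rwa [map_add, map_smul, h2, smul_zero, add_zero, h3] at this
  have q1 := hxt 0 (left_mem_Icc.2 zero_le_one) 1
  have q2 := hxt 1 (right_mem_Icc.2 zero_le_one) 0
  simp only [one_smul, zero_smul, add_zero] at q1 q2
  exact le_antisymm q2 q1

end LBK

namespace LBK
open Filter Topology
variable {V : Type*} [NormedAddCommGroup V] [NormedSpace ℝ V]

theorem near_graph {X : Submodule ℝ V} {P : V →L[ℝ] V}
    (hfix : ∀ x ∈ X, P x = x) {δ : ℝ} (hδ : 0 < δ) :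
    ∀ᶠ T : V →L[ℝ] V in 𝓝 1, ∀ x ∈ X, ‖T x - P (T x)‖ ≤ δ * ‖P (T x)‖ := by
  obtain ⟨c, hc⟩ : ∃ c, c = ‖P‖ + 1 := ⟨_, rfl⟩
  have hcp : 0 < c := by rw [hc]; positivity
  have : ∀ᶠ T : V →L[ℝ] V in 𝓝 1, ‖T - 1‖ < min (1 / 2) (δ / 2) / c := by
    have hcont : Continuous fun T : V →L[ℝ] V => ‖T - 1‖ := by fun_prop
    exact hcont.continuousAt.eventually (gt_mem_nhds (by simp; positivity))
  filter_upwards [this] with T hT x hx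
  rw [lt_div_iff₀ hcp] at hT
  set w := (T - 1) x with hw
  have hwn : ‖w‖ ≤ ‖T - 1‖ * ‖x‖ := (T - 1).le_opNorm x
  have hTx : T x = x + w := by simp [hw]
  have hPw : ‖P w‖ ≤ ‖P‖ * ‖w‖ := P.le_opNorm w
  have e1 : T x - P (T x) = w - P w := by rw [hTx, map_add, hfix x hx]; abel
  have e2 : P (T x) = x + P w := by rw [hTx, map_add, hfix x hx]
  have n1 : ‖w - P w‖ ≤ c * ‖w‖ := (norm_sub_le _ _).trans (by rw [hc]; linarith)
  have n2 : ‖x‖ - ‖P w‖ ≤ ‖x + P w‖ := by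
    have := norm_sub_le (x + P w) (P w)
    rw [add_sub_cancel_right] at this
    linarith
  have n3 : c * ‖w‖ ≤ min (1 / 2) (δ / 2) * ‖x‖ := by
    calc c * ‖w‖ ≤ c * (‖T - 1‖ * ‖x‖) := by gcongr
      _ = (‖T - 1‖ * c) * ‖x‖ := by ring
      _ ≤ _ := by gcongr
  have n4 : min (1 / 2) (δ / 2) * ‖x‖ ≤ 1 / 2 * ‖x‖ := by gcongr; exact min_le_left _ _
  have n5 : min (1 / 2) (δ / 2) * ‖x‖ ≤ δ / 2 * ‖x‖ := by gcongr; exact min_le_right _ _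
  have n6 : ‖P w‖ ≤ c * ‖w‖ := by rw [hc]; linarith [norm_nonneg w]
  rw [e1, e2]
  have n7 : ‖x‖ / 2 ≤ ‖x + P w‖ := by linarith
  have n8 : δ * (‖x‖ / 2) ≤ δ * ‖x + P w‖ := by gcongr
  linarith

theorem c1_open [FiniteDimensional ℝ V] {Φ : V → ℝ} {k : ℕ} {G : Submodule ℝ V → Prop}
    (h : IsMN Φ) (hk : 2 ≤ k) (F : Fam Φ k G) {X X0 : Submodule ℝ V} (hX : G X) (hX0 : G X0)
    {P0 : V →L[ℝ] V} (hP0 : Contr Φ X0 P0) (hpar : ¬ Par Φ X0)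
    (hS : ∀ v ∈ X, Φ (P0 v) = Φ v) :
    ∀ᶠ T : V →L[ℝ] V in 𝓝 1, ∀ v ∈ X.map (T : V →ₗ[ℝ] V), Φ (P0 v) = Φ v := by
  let R : V →ₗ[ℝ] X0 := (P0 : V →ₗ[ℝ] V).codRestrict X0 hP0.mem
  let L : X →ₗ[ℝ] X0 := R ∘ₗ X.subtype
  have hL : ∀ x : X, (L x : V) = P0 x := fun x => rfl
  have hinj : Function.Injective L := by
    rw [injective_iff_map_eq_zero]
    intro a ha
    have h1 := hS a a.2
    rw [← hL, ha, Submodule.coe_zero, h.zero] at h1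
    exact Subtype.ext (h.eq_zero h1.symm)
  have hsurj : Function.Surjective L :=
    (LinearMap.injective_iff_surjective_of_finrank_eq_finrank
      (by rw [F.rank X hX, F.rank X0 hX0])).1 hinj
  have hparX : ¬ Par Φ X := by
    intro hp
    apply hpar
    intro a ha b hb
    obtain ⟨x, hx⟩ := hsurj ⟨a, ha⟩
    obtain ⟨y, hy⟩ := hsurj ⟨b, hb⟩
    have ex : P0 x = a := by rw [← hL, hx]
    have ey : P0 y = b := by rw [← hL, hy]
    rw [← ex, ← ey, ← map_add, ← map_sub, hS _ x.2, hS _ y.2, hS _ (X.add_mem x.2 y.2),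
      hS _ (X.sub_mem x.2 y.2)]
    exact hp x x.2 y y.2
  let Le := LinearEquiv.ofBijective L ⟨hinj, hsurj⟩
  let PX : V →L[ℝ] V := LinearMap.toContinuousLinearMap (X.subtype ∘ₗ Le.symm.toLinearMap ∘ₗ R)
  have hPX : ∀ v, PX v ∈ X := fun v => (Le.symm (R v)).2
  have hPP : ∀ v, P0 (PX v) = P0 v := fun v => by
    have : L (Le.symm (R v)) = R v := Le.apply_symm_apply (R v)
    exact congrArg Subtype.val this
  have hc : Contr Φ X PX := by
    refine ⟨hPX, fun x hx => ?_, fun v => ?_⟩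
    · have : Le.symm (L ⟨x, hx⟩) = ⟨x, hx⟩ := Le.symm_apply_apply ⟨x, hx⟩
      exact congrArg Subtype.val this
    · rw [← hS _ (hPX v), hPP]; exact hP0.le v
  obtain ⟨δ, hδ, H⟩ := nonpar_unif h hk F hX hc hparX
  filter_upwards [near_graph hc.fix hδ] with T hT
  rintro _ ⟨x, hx, rfl⟩
  have h1 := H (PX (T x)) (hPX _) (T x - PX (T x))
    (by rw [map_sub, hc.fix _ (hPX _), sub_self]) (hT x hx)
  rw [add_sub_cancel] at h1
  show Φ (P0 (T x)) = Φ (T x)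
  rw [h1, ← hS _ (hPX _), hPP]

theorem quad_of_par [FiniteDimensional ℝ V] {Q : V → ℝ} (hc : Continuous Q)
    (hp : ∀ x y, Q (x + y) + Q (x - y) = 2 * Q x + 2 * Q y) :
    ∃ q : QuadraticForm ℝ V, ∀ v, q v = Q v := by
  have h0 : Q 0 = 0 := by have := hp 0 0; simp at this; linarith
  have hneg : ∀ v, Q (-v) = Q v := fun v => by
    have := hp 0 v; simp [h0] at this; linarith
  have h3 : ∀ u v w, Q (u + v + w) = Q (u + w) + Q (v + w) + Q (u + v) - Q u - Q v - Q w := by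
    intro u v w
    have a1 := hp (u + w) v
    have a2 := hp (v + w) u
    have a3 := hp w (u - v)
    have a4 := hp u v
    rw [show u + w + v = u + v + w by abel, show u + w - v = w + (u - v) by abel] at a1
    rw [show v + w + u = u + v + w by abel, show v + w - u = w - (u - v) by abel] at a2
    linarith
  let b : V → V → ℝ := fun u v => Q (u + v) - Q u - Q v
  have hadd : ∀ u u' v, b (u + u') v = b u v + b u' v := fun u u' v => by
    simp only [b, h3 u u' v]; ring
  have hsymm : ∀ u v, b u v = b v u := fun u v => by simp only [b, add_comm]; ring
  have hlin : ∀ v, ∃ f : V →L[ℝ] ℝ, ∀ u, f u = b u v := by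
    intro v
    let f : V →+ ℝ := AddMonoidHom.mk' (fun u => b u v) (fun u u' => hadd u u' v)
    exact ⟨f.toRealLinearMap (by show Continuous fun u => Q (u + v) - Q u - Q v; fun_prop),
      fun u => rfl⟩
  have hsmul : ∀ (c : ℝ) u v, b (c • u) v = c * b u v := fun c u v => by
    obtain ⟨f, hf⟩ := hlin v
    rw [← hf, ← hf, map_smul, smul_eq_mul]
  let B : LinearMap.BilinMap ℝ V ℝ := LinearMap.mk₂ ℝ b hadd hsmul
    (fun u v v' => by rw [hsymm, hadd, hsymm v, hsymm v'])
    (fun c u v => by rw [hsymm, hsmul, hsymm v]; rfl)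
  refine ⟨(1 / 2 : ℝ) • B.toQuadraticMap, fun v => ?_⟩
  have : B.toQuadraticMap v = b v v := rfl
  rw [smul_apply, this]
  have a := hp v v
  rw [sub_self, h0] at a
  simp only [b, smul_eq_mul]
  linarith

theorem quad_eq {q q' : QuadraticForm ℝ V} {x : V} (h : ∀ᶠ v in 𝓝 x, q v = q' v) : q = q' := by
  ext w
  have hc : Continuous fun t : ℝ => x + t • w := by fun_prop
  have h1 : ∀ᶠ t : ℝ in 𝓝 0, q (x + t • w) = q' (x + t • w) :=
    (hc.tendsto' 0 x (by simp)).eventually h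
  obtain ⟨ε, hε, H⟩ := Metric.eventually_nhds_iff.1 h1
  have ex : ∀ (p : QuadraticForm ℝ V) (t : ℝ), p (x + t • w) =
      p x + t * QuadraticMap.polar p x w + t ^ 2 * p w := by
    intro p t
    have e1 := QuadraticMap.map_add p x (t • w)
    rw [e1, QuadraticMap.map_smul, QuadraticMap.polar_smul_right]
    simp only [smul_eq_mul]; ring
  have a0 := H (y := 0) (by simpa using hε)
  have a1 := H (y := ε / 2) (by simp [abs_of_pos hε]; linarith)
  have a2 := H (y := -(ε / 2)) (by simp [abs_of_pos hε]; linarith)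
  simp only [ex] at a0 a1 a2
  have : (ε / 2) ^ 2 * (q w - q' w) = 0 := by nlinarith
  have := (mul_eq_zero.1 this).resolve_left (by positivity)
  linarith

/-- `q` agrees with `Φ ^ 2` on all planes near `X`. -/
def Loc (Φ : V → ℝ) (q : QuadraticForm ℝ V) (X : Submodule ℝ V) : Prop :=
  ∀ᶠ T : V →L[ℝ] V in 𝓝 1, ∀ v ∈ X.map (T : V →ₗ[ℝ] V), q v = Φ v ^ 2

theorem Loc.opn {Φ : V → ℝ} {q : QuadraticForm ℝ V} {X : Submodule ℝ V} (h : Loc Φ q X) :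
    ∀ᶠ T : V →L[ℝ] V in 𝓝 1, Loc Φ q (X.map (T : V →ₗ[ℝ] V)) := by
  have := eventually_eventually_nhds.2 h
  filter_upwards [this] with T hT
  have hc : Continuous fun T' : V →L[ℝ] V => T' * T := by fun_prop
  have := (hc.tendsto' 1 T (by simp)).eventually hT
  filter_upwards [this] with T' hT'
  rintro _ ⟨_, ⟨x, hx, rfl⟩, rfl⟩
  exact hT' _ ⟨x, hx, rfl⟩

theorem Loc.uniq {Φ : V → ℝ} {q q' : QuadraticForm ℝ V} {X : Submodule ℝ V} (h : Loc Φ q X)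
    (h' : Loc Φ q' X) {x : V} (hx : x ∈ X) (hx0 : x ≠ 0) : q = q' := by
  obtain ⟨f, hf1, hf2⟩ := exists_dual_vector ℝ x (norm_ne_zero_iff.2 hx0)
  apply quad_eq (x := x)
  have hc : Continuous fun v : V => (1 : V →L[ℝ] V) + (‖x‖⁻¹ • f).smulRight (v - x) := by
    have h1 : Continuous (fun v => (ContinuousLinearMap.smulRightL ℝ V V (‖x‖⁻¹ • f)) (v - x)) := by
      fun_prop
    exact continuous_const.add h1
  have h2 := (show ∀ᶠ T : V →L[ℝ] V in 𝓝 1, _ from h).and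
    (show ∀ᶠ T : V →L[ℝ] V in 𝓝 1, _ from h')
  have := (hc.tendsto' x 1 (by ext; simp)).eventually h2
  filter_upwards [this] with v hv
  have hm : v ∈ X.map (((1 : V →L[ℝ] V) + (‖x‖⁻¹ • f).smulRight (v - x) : V →L[ℝ] V) :
      V →ₗ[ℝ] V) := ⟨x, hx, by simp [hf2, hx0]⟩
  rw [hv.1 v hm, hv.2 v hm]

end LBK

namespace LBK
open Filter Topology
variable {V : Type*} [NormedAddCommGroup V] [NormedSpace ℝ V]

theorem arith_half {D : ℝ → ℝ} (hD : ∀ s, 0 ≤ D s)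
    (h : ∀ s, D (s + 1) + D (s - 1) = 2 * D s) : D 0 ≤ D 1 := by
  have h1 : ∀ n : ℕ, D (n + 1) - D n = D 1 - D 0 := by
    intro n
    induction n with
    | zero => simp
    | succ m ih =>
      have := h (m + 1)
      rw [add_sub_cancel_right] at this
      push_cast
      linarith
  have h2 : ∀ n : ℕ, D n = D 0 + n * (D 1 - D 0) := by
    intro n
    induction n with
    | zero => simp
    | succ m ih =>
      have := h1 m
      push_cast
      linarith
  by_contra hlt
  push Not at hlt
  have hp : 0 < D 0 - D 1 := by linarith
  obtain ⟨n, hn⟩ := exists_nat_gt (D 0 / (D 0 - D 1))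
  rw [div_lt_iff₀ hp] at hn
  have := hD n
  rw [h2 n] at this
  linarith

theorem arith {D : ℝ → ℝ} (hD : ∀ s, 0 ≤ D s)
    (h : ∀ s, D (s + 1) + D (s - 1) = 2 * D s) : D 1 = D 0 := by
  apply le_antisymm
  · have := arith_half (D := fun s => D (1 - s)) (fun s => hD _) (fun s => by
      have := h (1 - s)
      rw [show 1 - (s + 1) = 1 - s - 1 by ring, show 1 - (s - 1) = 1 - s + 1 by ring]
      linarith)
    simpa using this
  · exact arith_half hD h

theorem v1 {Φ : V → ℝ} {X : Submodule ℝ V} {P1 : V →L[ℝ] V} (h : IsMN Φ)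
    (hP1 : Contr Φ X P1) (hp : Par Φ X) {l : V →L[ℝ] ℝ} {y : V} (hy : P1 y = 0)
    (hpg : Par Φ (Xg X l y)) {x x' : V} (hx : x ∈ X) (hx' : x' ∈ X) (hl : l x = 1)
    (hl' : l x' = 1) : Φ (x' + y) ^ 2 - Φ x' ^ 2 = Φ (x + y) ^ 2 - Φ x ^ 2 := by
  obtain ⟨z, hz⟩ : ∃ z, z = x' - x := ⟨_, rfl⟩
  have hzX : z ∈ X := hz ▸ X.sub_mem hx' hx
  have hlz : l z = 0 := by rw [hz, map_sub, hl, hl', sub_self]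
  have hmX : ∀ s : ℝ, x + s • z ∈ X := fun s => X.add_mem hx (X.smul_mem _ hzX)
  have := arith (D := fun s => Φ (x + s • z + y) ^ 2 - Φ (x + s • z) ^ 2) (fun s => by
    have h1 := hP1.le (x + s • z + y)
    rw [map_add, hy, add_zero, hP1.fix _ (hmX s)] at h1
    have h2 := h.nonneg (x + s • z)
    have := pow_le_pow_left₀ h2 h1 2
    linarith) (fun s => by
    have a1 := hp _ (hmX s) z hzX
    have a2 := hpg (x + s • z + y) (mem_Xg.2 ⟨_, hmX s, by simp [hl, hlz]⟩) z
      (mem_Xg.2 ⟨z, hzX, by simp [hlz]⟩)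
    rw [show x + (s + 1) • z + y = x + s • z + y + z by module,
      show x + (s - 1) • z + y = x + s • z + y - z by module,
      show x + (s + 1) • z = x + s • z + z by module,
      show x + (s - 1) • z = x + s • z - z by module]
    linarith)
  simpa [hz] using this

theorem v2 {X : Submodule ℝ V} {d : V → ℝ} {S : (V →L[ℝ] ℝ) → Prop}
    (hd : ∀ l, S l → ∀ x ∈ X, ∀ x' ∈ X, l x = 1 → l x' = 1 → d x' = d x)
    {α β l : V →L[ℝ] ℝ} {e f : V} (he : e ∈ X) (hf : f ∈ X)
    (a1 : α e = 1) (a2 : α f = 0) (a3 : β e = 0) (a4 : β f = 1) {τ : ℝ} (hτ : 0 < τ)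
    (hα : S (τ • α)) (hβ : S (τ • β)) (hl : S l) {x : V} (hx : x ∈ X) (hlx : l x = 1) :
    d x = d (τ⁻¹ • e) := by
  have hτ' := hτ.ne'
  have me : τ⁻¹ • e ∈ X := X.smul_mem _ he
  have mf : τ⁻¹ • f ∈ X := X.smul_mem _ hf
  by_cases hb : l f = 0
  · by_cases ha : l e = 0
    · have mx : x + (τ⁻¹ - α x) • e ∈ X := X.add_mem hx (X.smul_mem _ he)
      rw [hd l hl _ mx x hx (by simp [hlx, ha]) hlx]
      exact hd _ hα _ me _ mx (by simp [a1, hτ']) (by simp [a1, hτ'])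
    · have mx : τ⁻¹ • f + ((1 - l f * τ⁻¹) / l e) • e ∈ X := X.add_mem mf (X.smul_mem _ he)
      have mef : τ⁻¹ • f + τ⁻¹ • e ∈ X := X.add_mem mf me
      rw [hd l hl _ mx x hx (by simp [ha, hb]) hlx]
      rw [hd _ hβ _ mf _ mx (by simp [a4, hτ']) (by simp [a3, a4, hτ'])]
      rw [hd _ hβ _ mef _ mf (by simp [a3, a4, hτ']) (by simp [a4, hτ'])]
      exact hd _ hα _ me _ mef (by simp [a1, hτ']) (by simp [a1, a2, hτ'])
  · have mx : τ⁻¹ • e + ((1 - l e * τ⁻¹) / l f) • f ∈ X := X.add_mem me (X.smul_mem _ hf)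
    rw [hd l hl _ mx x hx (by simp; field_simp; ring) hlx]
    exact hd _ hα _ me _ mx (by simp [a1, hτ']) (by simp [a1, a2, hτ'])

theorem exists_dual [FiniteDimensional ℝ V] {Φ : V → ℝ} {X : Submodule ℝ V} {P1 : V →L[ℝ] V}
    (hP1 : Contr Φ X P1) (hX : 2 ≤ finrank ℝ X) :
    ∃ (e f : V) (α β : V →L[ℝ] ℝ), e ∈ X ∧ f ∈ X ∧ α e = 1 ∧ α f = 0 ∧ β e = 0 ∧ β f = 1 := by
  let b := finBasis ℝ X
  let R : V →L[ℝ] X := P1.codRestrict X hP1.mem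
  have hR : ∀ x : X, R x = x := fun x => by
    apply Subtype.ext; simp [R, hP1.fix x x.2]
  let i : Fin (finrank ℝ X) := ⟨0, by omega⟩
  let j : Fin (finrank ℝ X) := ⟨1, by omega⟩
  have hij : i ≠ j := by simp [i, j]
  refine ⟨b i, b j, (LinearMap.toContinuousLinearMap (b.coord i)).comp R,
    (LinearMap.toContinuousLinearMap (b.coord j)).comp R, (b i).2, (b j).2, ?_, ?_, ?_, ?_⟩ <;>
    simp [hR, hij, hij.symm]

theorem claimK [FiniteDimensional ℝ V] {Φ : V → ℝ} {X : Submodule ℝ V} {P1 : V →L[ℝ] V}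
    (h : IsMN Φ) (hP1 : Contr Φ X P1) (hp : Par Φ X) {e0 : ℝ} (he0 : 0 < e0)
    (hpar : ∀ T : V →L[ℝ] V, ‖T - 1‖ < e0 → Par Φ (X.map (T : V →ₗ[ℝ] V)))
    {α β : V →L[ℝ] ℝ} {e f : V} (he : e ∈ X) (hf : f ∈ X)
    (a1 : α e = 1) (a2 : α f = 0) (a3 : β e = 0) (a4 : β f = 1) {y : V} (hy : P1 y = 0)
    {x x' : V} (hx : x ∈ X) (hx' : x' ∈ X) (hx0 : x ≠ 0) (hx0' : x' ≠ 0)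
    (hn : ‖y‖ ≤ e0 / 2 * ‖x‖) (hn' : ‖y‖ ≤ e0 / 2 * ‖x'‖) :
    Φ (x' + y) ^ 2 - Φ x' ^ 2 = Φ (x + y) ^ 2 - Φ x ^ 2 := by
  have hd : ∀ l : V →L[ℝ] ℝ, ‖l‖ * ‖y‖ < e0 → ∀ x ∈ X, ∀ x' ∈ X, l x = 1 → l x' = 1 →
      Φ (x' + y) ^ 2 - Φ x' ^ 2 = Φ (x + y) ^ 2 - Φ x ^ 2 := by
    intro l hl x hx x' hx' h1 h2
    refine v1 h hP1 hp hy (l := l) (hpar _ ?_) hx hx' h1 h2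
    rwa [add_sub_cancel_left, ContinuousLinearMap.norm_smulRight_apply]
  obtain ⟨τ, hτ, hα, hβ⟩ : ∃ τ : ℝ, 0 < τ ∧ ‖τ • α‖ * ‖y‖ < e0 ∧ ‖τ • β‖ * ‖y‖ < e0 := by
    have key : ∀ γ : V →L[ℝ] ℝ, ∀ᶠ τ : ℝ in 𝓝[>] 0, ‖τ • γ‖ * ‖y‖ < e0 := by
      intro γ
      apply nhdsWithin_le_nhds
      have hc : Continuous fun τ : ℝ => ‖τ • γ‖ * ‖y‖ := by fun_prop
      exact hc.continuousAt.eventually (gt_mem_nhds (by simpa using he0))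
    obtain ⟨τ, h1, h2, h3⟩ := ((key α).and ((key β).and self_mem_nhdsWithin)).exists
    exact ⟨τ, h3, h1, h2⟩
  have main : ∀ x ∈ X, x ≠ 0 → ‖y‖ ≤ e0 / 2 * ‖x‖ →
      Φ (x + y) ^ 2 - Φ x ^ 2 = Φ (τ⁻¹ • e + y) ^ 2 - Φ (τ⁻¹ • e) ^ 2 := by
    intro x hx hx0 hn
    have hxp : 0 < ‖x‖ := norm_pos_iff.2 hx0
    obtain ⟨g, hg1, hg2⟩ := exists_dual_vector ℝ x hxp.ne'
    refine v2 (d := fun x => Φ (x + y) ^ 2 - Φ x ^ 2) hd he hf a1 a2 a3 a4 hτ hα hβ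
      (l := ‖x‖⁻¹ • g) ?_ hx (by simp [hg2, hxp.ne'])
    rw [norm_smul, hg1, norm_inv, norm_norm, mul_one]
    calc ‖x‖⁻¹ * ‖y‖ ≤ ‖x‖⁻¹ * (e0 / 2 * ‖x‖) := by gcongr
      _ = e0 / 2 := by field_simp
      _ < e0 := by linarith
  rw [main x hx hx0 hn, main x' hx' hx0' hn']

theorem quad_local [FiniteDimensional ℝ V] {Φ : V → ℝ} {k : ℕ} {G : Submodule ℝ V → Prop}
    (h : IsMN Φ) (hk : 2 ≤ k) (F : Fam Φ k G) (hG : ∀ X, G X → Par Φ X)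
    {X : Submodule ℝ V} (hX : G X) :
    ∃ Q : QuadraticForm ℝ V, (∀ v, 0 ≤ Q v) ∧ Loc Φ Q X := by
  obtain ⟨P1, hP1⟩ := F.contr X hX
  obtain ⟨e0, he0, hop⟩ := Metric.eventually_nhds_iff.1 (F.opn X hX)
  have hpar : ∀ T : V →L[ℝ] V, ‖T - 1‖ < e0 → Par Φ (X.map (T : V →ₗ[ℝ] V)) :=
    fun T hT => hG _ (hop (by rwa [dist_eq_norm]))
  have hp := hG X hX
  obtain ⟨e, f, α, β, he, hf, a1, a2, a3, a4⟩ := exists_dual hP1 (by rw [F.rank X hX]; exact hk)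
  obtain ⟨δ, hδd⟩ : ∃ δ, δ = e0 / 2 := ⟨_, rfl⟩
  have hδ : 0 < δ := by rw [hδd]; positivity
  have ne : ∀ v, α v ≠ 0 → 0 < ‖v‖ := fun v hv => norm_pos_iff.2 (by rintro rfl; simp at hv)
  have hen : 0 < ‖e‖ := ne e (by simp [a1])
  have hfn : 0 < ‖f‖ := norm_pos_iff.2 (by rintro rfl; simp at a4)
  have hefn : 0 < ‖e + f‖ := ne _ (by simp [a1, a2])
  have hefn' : 0 < ‖e - f‖ := ne _ (by simp [a1, a2])
  let r : V → ℝ := fun y => ‖y‖ / (δ * ‖e‖) + 1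
  have hr : ∀ y, 0 < r y := fun y => by positivity
  have hr' : ∀ y, ‖y‖ < δ * ‖r y • e‖ := fun y => by
    rw [norm_smul, Real.norm_of_nonneg (hr y).le]
    have : δ * (r y * ‖e‖) = ‖y‖ + δ * ‖e‖ := by simp only [r]; field_simp
    rw [this]
    have : 0 < δ * ‖e‖ := by positivity
    linarith
  let c : V → ℝ := fun y => Φ (r y • e + y) ^ 2 - Φ (r y • e) ^ 2
  have hre : ∀ y, r y • e ≠ 0 := fun y => smul_ne_zero (hr y).ne' (norm_pos_iff.1 hen)
  have hc : ∀ y, P1 y = 0 → ∀ x ∈ X, x ≠ 0 → ‖y‖ ≤ δ * ‖x‖ →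
      Φ (x + y) ^ 2 - Φ x ^ 2 = c y := by
    intro y hy x hx hx0 hn
    exact claimK h hP1 hp he0 hpar he hf a1 a2 a3 a4 hy (X.smul_mem _ he) hx (hre y) hx0
      (by rw [← hδd]; exact (hr' y).le) (by rw [← hδd]; exact hn)
  have hc0 : ∀ y, P1 y = 0 → 0 ≤ c y := by
    intro y hy
    have h1 := hP1.le (r y • e + y)
    rw [map_add, hy, add_zero, hP1.fix _ (X.smul_mem _ he)] at h1
    have := pow_le_pow_left₀ (h.nonneg (r y • e)) h1 2
    simp only [c]
    linarith
  have hcp : ∀ y1 y2, P1 y1 = 0 → P1 y2 = 0 →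
      c (y1 + y2) + c (y1 - y2) = 2 * c y1 + 2 * c y2 := by
    intro y1 y2 h1 h2
    obtain ⟨N, hN⟩ : ∃ N, N = ‖y1‖ + ‖y2‖ := ⟨_, rfl⟩
    have big : ∀ w : V, 0 < ‖w‖ → ∀ᶠ R : ℝ in atTop, N ≤ δ * (R * ‖w‖) := by
      intro w hw
      filter_upwards [eventually_ge_atTop (N / (δ * ‖w‖))] with R hR
      rw [div_le_iff₀ (by positivity)] at hR
      linarith
    obtain ⟨M, hM⟩ : ∃ M, M = ‖α.smulRight y1 + β.smulRight y2‖ := ⟨_, rfl⟩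
    obtain ⟨R, hR0, hR1, b1, b2, b3, b4⟩ := ((eventually_gt_atTop 0).and
      ((eventually_gt_atTop (M / e0)).and ((big e hen).and ((big f hfn).and
        ((big _ hefn).and (big _ hefn')))))).exists
    rw [div_lt_iff₀ he0] at hR1
    let T : V →L[ℝ] V := 1 + R⁻¹ • (α.smulRight y1 + β.smulRight y2)
    have hT : Par Φ (X.map (T : V →ₗ[ℝ] V)) := by
      apply hpar
      simp only [T]
      rw [add_sub_cancel_left, norm_smul, ← hM, norm_inv, Real.norm_of_nonneg hR0.le,
        inv_mul_lt_iff₀ hR0]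
      exact hR1
    have m1 : R • e + y1 ∈ X.map (T : V →ₗ[ℝ] V) :=
      ⟨R • e, X.smul_mem _ he, by simp [T, a1, a3, hR0.ne']⟩
    have m2 : R • f + y2 ∈ X.map (T : V →ₗ[ℝ] V) :=
      ⟨R • f, X.smul_mem _ hf, by simp [T, a2, a4, hR0.ne']⟩
    have p1 := hT _ m1 _ m2
    have p2 := hp (R • e) (X.smul_mem _ he) (R • f) (X.smul_mem _ hf)
    have hcc : ∀ y, P1 y = 0 → ‖y‖ ≤ N → ∀ w ∈ X, 0 < ‖w‖ → N ≤ δ * (R * ‖w‖) →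
        Φ (R • w + y) ^ 2 - Φ (R • w) ^ 2 = c y := by
      intro y hy hyN w hw hwn hb
      refine hc y hy _ (X.smul_mem _ hw) (smul_ne_zero hR0.ne' (norm_pos_iff.1 hwn)) ?_
      rw [norm_smul, Real.norm_of_nonneg hR0.le]
      exact hyN.trans hb
    have q1 := hcc y1 h1 (by rw [hN]; linarith [norm_nonneg y2]) e he hen b1
    have q2 := hcc y2 h2 (by rw [hN]; linarith [norm_nonneg y1]) f hf hfn b2
    have q3 := hcc (y1 + y2) (by simp [h1, h2]) (by rw [hN]; exact norm_add_le _ _) _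
      (X.add_mem he hf) hefn b3
    have q4 := hcc (y1 - y2) (by simp [h1, h2]) (by rw [hN]; exact norm_sub_le _ _) _
      (X.sub_mem he hf) hefn' b4
    rw [show R • e + y1 + (R • f + y2) = R • (e + f) + (y1 + y2) by module,
      show R • e + y1 - (R • f + y2) = R • (e - f) + (y1 - y2) by module] at p1
    rw [← smul_add, ← smul_sub] at p2
    linarith
  have hk0 : ∀ v, P1 (v - P1 v) = 0 := fun v => by
    rw [map_sub, hP1.fix _ (hP1.mem v), sub_self]
  have hΦ := h.cont
  have hcont : Continuous fun v => c (v - P1 v) := by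
    rw [continuous_iff_continuousAt]
    intro v0
    let r0 := r (v0 - P1 v0)
    have hg : Continuous fun v => Φ (r0 • e + (v - P1 v)) ^ 2 - Φ (r0 • e) ^ 2 := by fun_prop
    refine hg.continuousAt.congr ?_
    have hn : Continuous fun v => ‖v - P1 v‖ := by fun_prop
    filter_upwards [hn.continuousAt.eventually (gt_mem_nhds (hr' (v0 - P1 v0)))] with v hv
    exact hc _ (hk0 v) _ (X.smul_mem _ he) (hre _) hv.le
  obtain ⟨q, hq⟩ := quad_of_par (Q := fun v => Φ (P1 v) ^ 2 + c (v - P1 v)) (by fun_prop) (by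
    intro x y
    have p1 := hp _ (hP1.mem x) _ (hP1.mem y)
    have p2 := hcp _ _ (hk0 x) (hk0 y)
    simp only [map_add, map_sub]
    rw [show x + y - (P1 x + P1 y) = x - P1 x + (y - P1 y) by abel,
      show x - y - (P1 x - P1 y) = x - P1 x - (y - P1 y) by abel]
    linarith)
  refine ⟨q, fun v => ?_, ?_⟩
  · rw [hq]
    have := hc0 _ (hk0 v)
    positivity
  · filter_upwards [near_graph hP1.fix hδ] with T hT
    rintro _ ⟨x, hx, rfl⟩
    show q (T x) = Φ (T x) ^ 2
    have h1 := hT x hx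
    by_cases hz : P1 (T x) = 0
    · have : T x = 0 := by simpa [hz] using h1
      rw [this, QuadraticMap.map_zero, h.zero]; simp
    · rw [hq, ← hc _ (hk0 (T x)) _ (hP1.mem (T x)) hz h1, add_sub_cancel, add_sub_cancel]

end LBK

namespace LBK
open Filter Topology
variable {V : Type*} [NormedAddCommGroup V] [NormedSpace ℝ V]

/-- membership of a plane in a subset of the Grassmannian -/
def inU {k : ℕ} (𝒰 : Set (Gr k V)) (X : Submodule ℝ V) : Prop :=
  ∃ h : finrank ℝ X = k, (⟨X, h⟩ : Gr k V) ∈ 𝒰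

theorem inU_opn [FiniteDimensional ℝ V] {k : ℕ} {𝒰 : Set (Gr k V)} (ho : IsOpen 𝒰)
    {X : Submodule ℝ V} (hX : inU 𝒰 X) :
    ∀ᶠ T : V →L[ℝ] V in 𝓝 1, inU 𝒰 (X.map (T : V →ₗ[ℝ] V)) := by
  obtain ⟨hr, hX⟩ := hX
  let b := finBasisOfFinrankEq ℝ X hr
  let v : Fin k → V := fun i => b i
  have hv : LinearIndependent ℝ v := b.linearIndependent.map' X.subtype X.ker_subtype
  have hrange : range v = (X.subtype : X → V) '' range b := by
    rw [← range_comp]; rfl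
  have hs : Submodule.span ℝ (range v) = X := by
    rw [hrange, ← Submodule.map_span, b.span_eq, Submodule.map_top, Submodule.range_subtype]
  obtain ⟨U, hU, hW⟩ := isOpen_induced_iff.1 (isOpen_coinduced.1 ho)
  have hc : Continuous fun T : V →L[ℝ] V => fun i => T (v i) := by fun_prop
  have hvU : v ∈ U := by
    have : (⟨v, hv⟩ : {v : Fin k → V // LinearIndependent ℝ v}) ∈ Subtype.val ⁻¹' U := by
      rw [hW]
      show (⟨Submodule.span ℝ (range v), _⟩ : Gr k V) ∈ 𝒰
      convert hX
    exact this
  have ht : Tendsto (fun T : V →L[ℝ] V => fun i => T (v i)) (𝓝 1) (𝓝 v) :=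
    hc.tendsto' 1 v (by ext; simp)
  filter_upwards [ht.eventually (hU.mem_nhds hvU), ht.eventually hv.eventually] with T h1 h2
  have hm : (⟨_, h2⟩ : {v : Fin k → V // LinearIndependent ℝ v}) ∈ Subtype.val ⁻¹' U := h1
  rw [hW] at hm
  have he : Submodule.span ℝ (range fun i => T (v i)) = X.map (T : V →ₗ[ℝ] V) := by
    conv_rhs => rw [← hs]
    rw [Submodule.map_span, ← range_comp]
    rfl
  have hm' : (⟨Submodule.span ℝ (range fun i => T (v i)), _⟩ : Gr k V) ∈ 𝒰 := hm
  unfold inU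
  rw [← he]
  exact ⟨_, hm'⟩

theorem opn_of [FiniteDimensional ℝ V] {k : ℕ} {S : Set (Gr k V)}
    (hS : ∀ X, inU S X → ∀ᶠ T : V →L[ℝ] V in 𝓝 1, inU S (X.map (T : V →ₗ[ℝ] V))) :
    IsOpen S := by
  refine isOpen_coinduced.2 (isOpen_iff_mem_nhds.2 ?_)
  rintro ⟨v, hv⟩ hvS
  have hX : inU S (Submodule.span ℝ (range v)) := ⟨_, hvS⟩
  have hker : LinearMap.ker (Fintype.linearCombination ℝ v) = ⊥ :=
    LinearMap.ker_eq_bot.2 (linearIndependent_iff_injective_fintypeLinearCombination.1 hv)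
  obtain ⟨g, hg⟩ := LinearMap.exists_leftInverse_of_injective _ hker
  have hgv : ∀ i, g (v i) = Pi.single i 1 := fun i => by
    have := LinearMap.congr_fun hg (Pi.single i 1)
    simpa using this
  let l : Fin k → V →L[ℝ] ℝ := fun i => LinearMap.toContinuousLinearMap (LinearMap.proj i ∘ₗ g)
  let T : (Fin k → V) → V →L[ℝ] V := fun w => 1 + ∑ i, (l i).smulRight (w i - v i)
  have hT : Continuous T := by
    have h1 : ∀ i, Continuous (fun w : Fin k → V =>
        (ContinuousLinearMap.smulRightL ℝ V V (l i)) (w i - v i)) := by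
      intro i; fun_prop
    exact continuous_const.add (continuous_finsetSum _ fun i _ => h1 i)
  have hTv : ∀ w i, T w (v i) = w i := by
    intro w i
    simp [T, l, hgv, Pi.single_apply]
  have ht : Tendsto (fun w : {v : Fin k → V // LinearIndependent ℝ v} => T w.1) (𝓝 ⟨v, hv⟩)
      (𝓝 1) := (hT.comp continuous_subtype_val).tendsto' _ _ (by
        ext x; simp [T])
  filter_upwards [ht.eventually (hS _ hX)] with w hw
  have he : (Submodule.span ℝ (range v)).map (T w.1 : V →ₗ[ℝ] V) =
      Submodule.span ℝ (range w.1) := by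
    rw [Submodule.map_span, ← range_comp]
    congr 2
    ext i
    exact hTv w.1 i
  unfold inU at hw
  rw [he] at hw
  exact hw.2

theorem conn [FiniteDimensional ℝ V] {k : ℕ} {𝒰 : Set (Gr k V)} (ho : IsOpen 𝒰)
    (hc : IsPreconnected 𝒰) (S : Submodule ℝ V → Prop) {X0 : Submodule ℝ V} (hX0 : inU 𝒰 X0)
    (hS0 : S X0)
    (h1 : ∀ X, inU 𝒰 X → S X → ∀ᶠ T : V →L[ℝ] V in 𝓝 1, S (X.map (T : V →ₗ[ℝ] V)))
    (h2 : ∀ X, inU 𝒰 X → ¬ S X → ∀ᶠ T : V →L[ℝ] V in 𝓝 1, ¬ S (X.map (T : V →ₗ[ℝ] V))) :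
    ∀ X, inU 𝒰 X → S X := by
  have key : ∀ S' : Submodule ℝ V → Prop,
      (∀ X, inU 𝒰 X → S' X → ∀ᶠ T : V →L[ℝ] V in 𝓝 1, S' (X.map (T : V →ₗ[ℝ] V))) →
      IsOpen {X : Gr k V | X ∈ 𝒰 ∧ S' X.1} := by
    intro S' h
    apply opn_of
    rintro X ⟨hr, hX, hS⟩
    filter_upwards [inU_opn ho ⟨hr, hX⟩, h X ⟨hr, hX⟩ hS] with T ⟨hr', hT⟩ hT'
    exact ⟨hr', hT, hT'⟩
  have := IsPreconnected.subset_left_of_subset_union (key S h1) (key (fun X => ¬ S X) h2)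
    (Set.disjoint_left.2 fun X hX hX' => hX'.2 hX.2)
    (fun X hX => by
      by_cases hS : S X.1
      · exact Or.inl ⟨hX, hS⟩
      · exact Or.inr ⟨hX, hS⟩)
    (let ⟨hr, hX⟩ := hX0; ⟨⟨X0, hr⟩, hX, hX, hS0⟩) hc
  rintro X ⟨hr, hX⟩
  exact (this hX).2

theorem gauge_mn {B : Set V} (hB : IsConvexBody B) (h0 : 0 ∈ interior B) :
    IsMN (gauge B) := by
  have hn : B ∈ 𝓝 (0 : V) := mem_interior_iff_mem_nhds.1 h0
  have ha : Absorbent ℝ B := absorbent_nhds_zero hn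
  refine ⟨fun c v hc => gauge_smul_of_nonneg hc v, gauge_add_le hB.2.1 ha, ?_, ?_⟩
  · obtain ⟨r, hr⟩ := hB.1.isBounded.subset_closedBall 0
    have hr' : B ⊆ Metric.closedBall 0 (max r 1) :=
      hr.trans (Metric.closedBall_subset_closedBall (le_max_left _ _))
    have hp : 0 < max r 1 := lt_max_of_lt_right one_pos
    refine ⟨(max r 1)⁻¹, by positivity, fun v => ?_⟩
    rw [← div_eq_inv_mul]
    exact le_gauge_of_subset_closedBall ha hp.le hr'
  · obtain ⟨r, hr, hb⟩ := Metric.mem_nhds_iff.1 hn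
    refine ⟨r⁻¹, by positivity, fun v => ?_⟩
    rw [← div_eq_inv_mul, le_div_iff₀ hr, mul_comm]
    exact mul_gauge_le_norm hb

theorem gauge_mem {B : Set V} (hB : IsConvexBody B) (h0 : 0 ∈ interior B) (v : V) :
    gauge B v ≤ 1 ↔ v ∈ B := by
  rw [gauge_le_one_iff_mem_closure hB.2.1 (mem_interior_iff_mem_nhds.1 h0),
    hB.1.isClosed.closure_eq]

theorem contr_of_cyl [FiniteDimensional ℝ V] {B C : Set V} (hB : IsConvexBody B)
    (h0 : 0 ∈ interior B) {k : ℕ} {X : Submodule ℝ V}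
    (hC : IsCylinderWithBase k C (B ∩ (X : Set V)) X) (hBC : B ⊆ C) :
    ∃ P : V →L[ℝ] V, Contr (gauge B) X P := by
  obtain ⟨-, -, -, -, -, Y, hXY, rfl⟩ := hC
  have h := gauge_mn hB h0
  let p := X.subtype ∘ₗ X.projectionOnto Y hXY
  have hfix : ∀ x ∈ X, p x = x := fun x hx => by
    simp only [p, LinearMap.comp_apply]
    rw [Submodule.projectionOnto_apply_left hXY ⟨x, hx⟩]
    rfl
  have hker : ∀ y ∈ Y, p y = 0 := fun y hy => by
    simp only [p, LinearMap.comp_apply]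
    rw [(Submodule.projectionOnto_apply_eq_zero_iff hXY).2 hy, map_zero]
  refine ⟨LinearMap.toContinuousLinearMap p, fun v => ?_, hfix, fun v => ?_⟩
  · exact (X.projectionOnto Y hXY v).2
  · show gauge B (p v) ≤ gauge B v
    by_cases hv : v = 0
    · rw [hv, map_zero]
    have hp : 0 < gauge B v := h.pos hv
    have hw : (gauge B v)⁻¹ • v ∈ B := by
      rw [← gauge_mem hB h0, h.hom _ _ (inv_nonneg.2 hp.le), inv_mul_cancel₀ hp.ne']
    obtain ⟨x, hx, y, hy, hxy⟩ := hBC hw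
    have e1 : p ((gauge B v)⁻¹ • v) = x := by
      rw [← hxy]
      simp only [map_add]
      rw [hfix x hx.2, hker y hy, add_zero]
    have e2 := (gauge_mem hB h0 x).2 hx.1
    rw [← e1, map_smul, h.hom _ _ (inv_nonneg.2 hp.le), inv_mul_le_iff₀ hp, mul_one] at e2
    exact e2

theorem final [FiniteDimensional ℝ V] (k : ℕ) (hk : 2 ≤ k)
    (B : Set V) (hB : IsConvexBody B) (h0 : 0 ∈ interior B)
    (𝒰 : Set (Gr k V)) (ho : IsOpen 𝒰) (hconn : IsConnected 𝒰)
    (hcyl : ∀ X ∈ 𝒰, ∃ C : Set V,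
      IsCylinderWithBase k C (B ∩ (X.1 : Set V)) X.1 ∧ B ⊆ C) :
    ∃ B' : Set V,
      (∀ X ∈ 𝒰, B ∩ (X.1 : Set V) = B' ∩ (X.1 : Set V)) ∧
      (IsCylinder k B' ∨
        ∃ Q : QuadraticForm ℝ V, (∀ v, 0 ≤ Q v) ∧ B' = {v | Q v ≤ 1}) := by
  have h := gauge_mn hB h0
  have hm := gauge_mem hB h0
  obtain ⟨Φ, hΦ⟩ : ∃ Φ, Φ = gauge B := ⟨_, rfl⟩
  have F : Fam Φ k (inU 𝒰) := by
    refine ⟨fun X hX => hX.1, ?_, fun X hX => inU_opn ho hX⟩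
    rintro X ⟨hr, hX⟩
    obtain ⟨C, hC, hBC⟩ := hcyl _ hX
    rw [hΦ]
    exact contr_of_cyl hB h0 hC hBC
  rw [← hΦ] at h hm
  have hcont := h.cont
  by_cases hall : ∀ X, inU 𝒰 X → Par Φ X
  · obtain ⟨⟨X0, hr0⟩, hX0⟩ := hconn.nonempty
    have hX0' : inU 𝒰 X0 := ⟨hr0, hX0⟩
    obtain ⟨Q0, hQ0, hL⟩ := quad_local h hk F hall hX0'
    have hS := conn ho hconn.isPreconnected (fun X => Loc Φ Q0 X) hX0' hL
      (fun X _ hX => hX.opn) (by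
        intro X hX hn
        obtain ⟨Q, hQ, hLQ⟩ := quad_local h hk F hall hX
        filter_upwards [hLQ.opn, F.opn X hX] with T hT1 hT2 hT3
        have hrk := F.rank _ hT2
        have hne : X.map (T : V →ₗ[ℝ] V) ≠ ⊥ := by
          intro hb
          rw [hb, finrank_bot] at hrk
          omega
        obtain ⟨x, hx, hx0⟩ := Submodule.exists_mem_ne_zero_of_ne_bot hne
        exact hn (hT1.uniq hT3 hx hx0 ▸ hLQ))
    refine ⟨{v | Q0 v ≤ 1}, ?_, Or.inr ⟨Q0, hQ0, rfl⟩⟩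
    rintro ⟨X, hr⟩ hX
    have hLX := (show ∀ᶠ T : V →L[ℝ] V in 𝓝 1, _ from hS X ⟨hr, hX⟩).self_of_nhds
    ext v
    refine and_congr_left fun hv => ?_
    have : Q0 v = Φ v ^ 2 := hLX v ⟨v, hv, rfl⟩
    show v ∈ B ↔ Q0 v ≤ 1
    rw [this, ← hm, sq_le_one_iff₀ (h.nonneg v)]
  · push Not at hall
    obtain ⟨X0, hX0, hp0⟩ := hall
    obtain ⟨P0, hP0⟩ := F.contr X0 hX0
    have hS := conn ho hconn.isPreconnected (fun X => ∀ v ∈ X, Φ (P0 v) = Φ v) hX0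
      (fun v hv => by rw [hP0.fix v hv])
      (fun X hX hS => c1_open h hk F hX hX0 hP0 hp0 hS) (by
        intro X hX hn
        push Not at hn
        obtain ⟨v, hv, hne⟩ := hn
        have hc : Continuous fun T : V →L[ℝ] V => Φ (P0 (T v)) - Φ (T v) := by fun_prop
        have hev := hc.continuousAt.eventually_ne (x := 1) (y := 0)
          (by simpa [sub_eq_zero] using hne)
        filter_upwards [hev] with T hT hT'
        exact hT (sub_eq_zero.2 (hT' (T v) ⟨v, hv, rfl⟩)))
    refine ⟨{v | Φ (P0 v) ≤ 1}, ?_, Or.inl ⟨B ∩ X0, X0, ?_⟩⟩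
    · rintro ⟨X, hr⟩ hX
      ext v
      refine and_congr_left fun hv => ?_
      show v ∈ B ↔ Φ (P0 v) ≤ 1
      rw [hS X ⟨hr, hX⟩ v hv, hm]
    · obtain ⟨hr0, hX0⟩ := hX0
      obtain ⟨C, ⟨c1, c2, c3, c4, c5, -⟩, -⟩ := hcyl _ hX0
      refine ⟨c1, c2, c3, c4, c5, ?_⟩
      let R : V →ₗ[ℝ] X0 := (P0 : V →ₗ[ℝ] V).codRestrict X0 hP0.mem
      have hR : ∀ v, (R v : V) = P0 v := fun v => rfl
      refine ⟨LinearMap.ker R, LinearMap.isCompl_of_proj fun x => Subtype.ext ?_, ?_⟩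
      · rw [hR, hP0.fix x x.2]
      · have hk0 : ∀ y, y ∈ LinearMap.ker R ↔ P0 y = 0 := fun y => by
          rw [LinearMap.mem_ker, ← hR, Submodule.coe_eq_zero]
        ext v
        constructor
        · intro hv
          refine ⟨P0 v, ⟨(hm _).1 hv, hP0.mem v⟩, v - P0 v, ?_, add_sub_cancel _ _⟩
          rw [SetLike.mem_coe, hk0, map_sub, hP0.fix _ (hP0.mem v), sub_self]
        · rintro ⟨x, ⟨hx, hx'⟩, y, hy, rfl⟩
          rw [SetLike.mem_coe, hk0] at hy
          show Φ (P0 (x + y)) ≤ 1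
          rw [map_add, hy, add_zero, hP0.fix x hx', hm]
          exact hx

end LBK

/-- **Local Blaschke--Kakutani theorem.**
If `B` is contained in a `k`-cylinder with base `B ∩ X` for every `k`-plane `X`
in a nonempty connected open set `𝒰` of the Grassmannian, then there is a set `B'`
agreeing with `B` on all planes of `𝒰` which is a `k`-cylinder or a sublevel set of a
nonnegative definite quadratic form. -/
theorem local_blaschke_kakutani
    {V : Type*} [NormedAddCommGroup V] [NormedSpace ℝ V] [FiniteDimensional ℝ V]
    (n k : ℕ) (hn : Module.finrank ℝ V = n) (hk : 2 ≤ k) (hkn : k < n)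
    (B : Set V) (hB : IsConvexBody B) (h0 : 0 ∈ interior B)
    (𝒰 : Set (Gr k V)) (h𝒰open : IsOpen 𝒰) (h𝒰conn : IsConnected 𝒰)
    (hcyl : ∀ X ∈ 𝒰, ∃ C : Set V,
      IsCylinderWithBase k C (B ∩ (X.1 : Set V)) X.1 ∧ B ⊆ C) :
    ∃ B' : Set V,
      (∀ X ∈ 𝒰, B ∩ (X.1 : Set V) = B' ∩ (X.1 : Set V)) ∧
      (IsCylinder k B' ∨
        ∃ Q : QuadraticForm ℝ V, (∀ v, 0 ≤ Q v) ∧ B' = {v | Q v ≤ 1}) := by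
  exact LBK.final k hk B hB h0 𝒰 h𝒰open h𝒰conn hcyl
end

section
/- Let X be a 3-dimensional real vector space, F : X → ℝ a continuous function, and 𝒰 ⊂ Gr₂ X a nonempty open set of 2-dimensional linear subspaces. Suppose that for every plane Π ∈ 𝒰 the restriction F|_Π is a quadratic form on Π. Then there exists a unique quadratic form Q on X such that F|_Π = Q|_Π for all Π ∈ 𝒰. -/
open Module Set Pointwise

lemma aux_q2 {V : Type*} [AddCommGroup V] [Module ℝ V] (q : QuadraticForm ℝ V) (u v : V) (s t : ℝ) :
    q (s • u + t • v) = q u * s^2 + (q (u+v) - q u - q v) * (s*t) + q v * t^2 := by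
  rw [QuadraticMap.map_add q (s • u), QuadraticMap.polar_smul_left, QuadraticMap.polar_smul_right,
    QuadraticMap.map_smul, QuadraticMap.map_smul]
  simp only [QuadraticMap.polar, smul_eq_mul]
  ring

lemma aux_q3 {V : Type*} [AddCommGroup V] [Module ℝ V] (q : QuadraticForm ℝ V) (u v w : V) (r s t : ℝ) :
    q (r • u + s • v + t • w) = q u * r^2 + q v * s^2 + q w * t^2 + (q (u+v) - q u - q v) * (r*s) 
     + (q (u+w) - q u - q w) * (r*t) + (q (v+w) - q v - q w) * (s*t) := by
  rw [QuadraticMap.map_add q (r • u + s • v), aux_q2, QuadraticMap.polar_add_left,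
    QuadraticMap.polar_smul_left, QuadraticMap.polar_smul_right, QuadraticMap.polar_smul_left, QuadraticMap.polar_smul_right,
    QuadraticMap.map_smul]
  simp only [QuadraticMap.polar, smul_eq_mul]
  ring

/-- a quadratic polynomial with three distinct roots has zero leading coefficient -/
lemma aux_roots {A B C x y z : ℝ} (hxy : x ≠ y) (hxz : x ≠ z) (hyz : y ≠ z)
   (h1 : A * x^2 + B * x + C = 0) (h2 : A * y^2 + B * y + C = 0) (h3 : A * z^2 + B * z + C = 0) : A = 0 := by
  have h4 : A * (x + y) + B = 0 := by
    apply mul_left_cancel₀ (sub_ne_zero.2 hxy); linear_combination h1 - h2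
  have h5 : A * (x + z) + B = 0 := by
    apply mul_left_cancel₀ (sub_ne_zero.2 hxz); linear_combination h1 - h3
  apply mul_left_cancel₀ (sub_ne_zero.2 hyz); linear_combination h4 - h5

lemma aux_eps {X : Type*} [NormedAddCommGroup X] [NormedSpace ℝ X] (S : Set (X × X)) (hS : IsOpen S)
   (a b c d : X) (h : (a, b) ∈ S) (T : Set ℝ) (hT : T.Finite) : 
   ∃ ε : ℝ, ε ∉ T ∧ (a + ε • c, b) ∈ S ∧ (a, b + ε • d) ∈ S := by
  have h1 : IsOpen ({ε : ℝ | (a + ε • c, b) ∈ S} ∩ {ε : ℝ | (a, b + ε • d) ∈ S}) :=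
    (hS.preimage (f := fun ε : ℝ => (a + ε • c, b)) (by fun_prop)).inter 
     (hS.preimage (f := fun ε : ℝ => (a, b + ε • d)) (by fun_prop))
  have h2 := infinite_of_mem_nhds (0:ℝ) (h1.mem_nhds (by simp [h]))
  obtain ⟨ε, he, hn⟩ := (h2.sdiff hT).nonempty
  exact ⟨ε, hn, he.1, he.2⟩

/-- abstract version -/
lemma aux_core {X : Type*} [NormedAddCommGroup X] [NormedSpace ℝ X]
    (hX : Module.finrank ℝ X = 3) (F : X → ℝ) (S : Set (X × X)) (hS : IsOpen S)
    (hne : S.Nonempty) 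
    (hLI : ∀ u v, (u, v) ∈ S → LinearIndependent ℝ ![u, v])
    (hq : ∀ u v, (u, v) ∈ S → ∃ A B C : ℝ, ∀ s t : ℝ, F (s • u + t • v) = A * s^2 + B * (s*t) + C * t^2) :
    ∃ Q : QuadraticForm ℝ X, (∀ u v, (u, v) ∈ S → F u = Q u) ∧
      ∀ Q' : QuadraticForm ℝ X, (∀ u v, (u, v) ∈ S → ∀ s t : ℝ, F (s • u + t • v) = Q' (s • u + t • v)) →
        Q' = Q := by
  have : FiniteDimensional ℝ X := Module.finite_of_finrank_eq_succ hX
  obtain ⟨⟨a, b⟩, hab⟩ := hne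
  obtain ⟨c, hc⟩ : ∃ c, c ∉ Submodule.span ℝ (Set.range ![a, b]) := by
    by_contra! h
    have h1 : Submodule.span ℝ (Set.range ![a, b]) = ⊤ := by
      rw [eq_top_iff]; intro x _; exact h x
    have h2 := finrank_span_eq_card (hLI a b hab)
    rw [h1, finrank_top, hX] at h2
    simp at h2
  obtain ⟨ε, he, hac, hbc⟩ := aux_eps S hS a b c c hab {0} (Set.finite_singleton _)
  simp only [Set.mem_singleton_iff] at he
  set e := a + b + ε • c with hedef
  have ha : a ∈ Submodule.span ℝ (Set.range ![a, b]) := Submodule.subset_span ⟨0, rfl⟩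
  have hb : b ∈ Submodule.span ℝ (Set.range ![a, b]) := Submodule.subset_span ⟨1, rfl⟩
  have hLI3 : LinearIndependent ℝ ![e, a, b] := by
    refine linearIndependent_finCons.2 ⟨hLI a b hab, fun h => hc ?_⟩
    have : c = ε⁻¹ • (e - a - b) := by
      rw [hedef, show a + b + ε • c - a - b = ε • c by abel, smul_smul, inv_mul_cancel₀ he, one_smul]
    rw [this]
    exact Submodule.smul_mem _ _ (Submodule.sub_mem _ (Submodule.sub_mem _ h ha) hb)
  let bs := basisOfLinearIndependentOfCardEqFinrank hLI3 (by simp [hX])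
  have hbs : ⇑bs = ![e, a, b] := coe_basisOfLinearIndependentOfCardEqFinrank _ _
  have hrep (x : X) : x = bs.coord 0 x • e + bs.coord 1 x • a + bs.coord 2 x • b := by
    conv_lhs => rw [← bs.sum_repr x]
    simp [Fin.sum_univ_three, hbs]
  have hLI' : ∀ x y z : ℝ, ∀ i, bs.coord i (x • e + y • a + z • b) = ![x,y,z] i := by
    intro x y z i
    have h0 : e = bs 0 := by simp [hbs]
    have h1 : a = bs 1 := by simp [hbs]
    have h2 : b = bs 2 := by simp [hbs]
    rw [h0, h1, h2]
    fin_cases i <;> simp [Finsupp.single_apply]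
  clear_value bs
  -- F on coordinate planes
  obtain ⟨A1, B1, C1, h1⟩ := hq _ _ hab
  obtain ⟨A2, B2, C2, h2⟩ := hq _ _ hac
  obtain ⟨A3, B3, C3, h3⟩ := hq _ _ hbc
  have k1 : ∀ s t : ℝ, F (s • a + t • b) = F a * s^2 + (F (a+b) - F a - F b) * (s*t) + F b * t^2 := by
    intro s t
    have p1 := h1 1 0; have p2 := h1 0 1; have p3 := h1 1 1
    simp at p1 p2 p3
    rw [h1, p1, p2, p3]; ring
  have k2 : ∀ s t : ℝ, F (s • e + t • b) = F e * s^2 + (F (e+b) - F e - F b) * (s*t) + F b * t^2 := by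
    intro s t
    have p1 := h2 1 1; have p2 := h2 0 1; have p3 := h2 1 2
    have p4 := h2 s (s + t)
    rw [show (1:ℝ) • (a + ε • c) + (1:ℝ) • b = e by rw [hedef]; module] at p1
    rw [show (1:ℝ) • (a + ε • c) + (2:ℝ) • b = e + b by rw [hedef]; module] at p3
    rw [show s • (a + ε • c) + (s + t) • b = s • e + t • b by rw [hedef]; module] at p4
    simp at p2
    rw [p4, p1, p2, p3]; ring
  have k3 : ∀ s t : ℝ, F (s • e + t • a) = F e * s^2 + (F (e+a) - F e - F a) * (s*t) + F a * t^2 := by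
    intro s t
    have p1 := h3 1 1; have p2 := h3 1 0; have p3 := h3 2 1
    have p4 := h3 (s + t) s
    rw [show (1:ℝ) • a + (1:ℝ) • (b + ε • c) = e by rw [hedef]; module] at p1
    rw [show (2:ℝ) • a + (1:ℝ) • (b + ε • c) = e + a by rw [hedef]; module] at p3
    rw [show (s+t) • a + s • (b + ε • c) = s • e + t • a by rw [hedef]; module] at p4
    simp at p2
    rw [p4, p1, p2, p3]; ring
  let L := QuadraticMap.linMulLin (R := ℝ) (M := X) (A := ℝ)
  let Q : QuadraticForm ℝ X := F e • L (bs.coord 0) (bs.coord 0) + F a • L (bs.coord 1) (bs.coord 1) 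
    + F b • L (bs.coord 2) (bs.coord 2) + (F (e+a) - F e - F a) • L (bs.coord 0) (bs.coord 1) 
    + (F (e+b) - F e - F b) • L (bs.coord 0) (bs.coord 2) + (F (a+b) - F a - F b) • L (bs.coord 1) (bs.coord 2)
  have hQ : ∀ x y z : ℝ, Q (x • e + y • a + z • b) = F e * x^2 + F a * y^2 + F b * z^2 
    + (F (e+a) - F e - F a) * (x*y) + (F (e+b) - F e - F b) * (x*z) + (F (a+b) - F a - F b) * (y*z) := by
    intro x y z
    simp only [Q, L, QuadraticMap.add_apply, QuadraticMap.smul_apply, QuadraticMap.linMulLin_apply, hLI', smul_eq_mul]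
    simp
    ring
  clear_value Q
  -- vanishing on the coordinate planes
  have hG : ∀ x : X, ∀ i, bs.coord i x = 0 → F x = Q x := by
    intro x i hi
    have hx := hrep x
    fin_cases i
    · simp only [Fin.zero_eta] at hi
      rw [hi] at hx
      rw [hx, hQ, zero_smul, zero_add, k1]; ring
    · simp only [Fin.mk_one] at hi
      rw [hi] at hx
      rw [hx, hQ, zero_smul, add_zero, k2]; ring
    · simp only [Fin.reduceFinMk] at hi
      rw [hi] at hx
      rw [hx, hQ, zero_smul, add_zero, k3]; ring
  -- key claim
  have key : ∀ w v, (w, v) ∈ S → F w = Q w := by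
    intro w v hwv
    by_cases hw : ∃ i, bs.coord i w = 0
    · obtain ⟨i, hi⟩ := hw; exact hG w i hi
    push Not at hw
    let r : Fin 3 → X → ℝ := fun i x => bs.coord i x / bs.coord i w
    let d : X := (0:ℝ) • e + bs.coord 1 w • a + (2 * bs.coord 2 w) • b
    have hd0 : r 0 d = 0 := by simp only [r, d, hLI']; simp
    have hd1 : r 1 d = 1 := by simp only [r, d, hLI']; simpa using div_self (hw 1)
    have hd2 : r 2 d = 2 := by
      simp only [r, d, hLI']; exact mul_div_cancel_right₀ _ (hw 2)
    obtain ⟨δ, hδ, -, hS'⟩ := aux_eps S hS w v 0 d hwv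
      {r 0 v - r 1 v, (r 0 v - r 2 v) / 2, r 1 v - r 2 v} (Set.toFinite _)
    simp only [Set.mem_insert_iff, Set.mem_singleton_iff, not_or] at hδ
    obtain ⟨n1, n2, n3⟩ := hδ
    have hr : ∀ i, r i (v + δ • d) = r i v + δ * r i d := by
      intro i; simp only [r, map_add, map_smul, smul_eq_mul]; ring
    obtain ⟨A, B, C, h⟩ := hq _ _ hS'
    have hz : ∀ i, (A - Q w) * (r i (v + δ • d))^2 + 
        (-(B - (Q (w + (v + δ • d)) - Q w - Q (v + δ • d)))) * r i (v + δ • d) + (C - Q (v + δ • d)) = 0 := by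
      intro i
      have := hG ((-(r i (v + δ • d))) • w + (1:ℝ) • (v + δ • d)) i (by
        rw [map_add, map_smul, map_smul]
        simp only [r, smul_eq_mul]
        rw [neg_mul, div_mul_cancel₀ _ (hw i)]; ring)
      rw [h, aux_q2] at this
      linear_combination this
    have hA : A - Q w = 0 := by
      refine aux_roots ?_ ?_ ?_ (hz 0) (hz 1) (hz 2)
      · rw [hr, hr, hd0, hd1]; intro hh; apply n1; linarith
      · rw [hr, hr, hd0, hd2]; intro hh; apply n2; linarith
      · rw [hr, hr, hd1, hd2]; intro hh; apply n3; linarith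
    have := h 1 0
    simp at this
    rw [this]; linarith
  refine ⟨Q, key, fun Q' hQ' => ?_⟩
  have e1 : F a = Q' a := by simpa using hQ' _ _ hab 1 0
  have e2 : F b = Q' b := by simpa using hQ' _ _ hab 0 1
  have e3 : F (a + b) = Q' (a + b) := by simpa using hQ' _ _ hab 1 1
  have e4 : F e = Q' e := by
    have := hQ' _ _ hac 1 1
    rwa [show (1:ℝ) • (a + ε • c) + (1:ℝ) • b = e by rw [hedef]; module] at this
  have e5 : F (e + b) = Q' (e + b) := by
    have := hQ' _ _ hac 1 2
    rwa [show (1:ℝ) • (a + ε • c) + (2:ℝ) • b = e + b by rw [hedef]; module] at this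
  have e6 : F (e + a) = Q' (e + a) := by
    have := hQ' _ _ hbc 2 1
    rwa [show (2:ℝ) • a + (1:ℝ) • (b + ε • c) = e + a by rw [hedef]; module] at this
  ext x
  rw [hrep x, hQ, aux_q3, e1, e2, e3, e4, e5, e6]

/-- **Quadratic forms in dimension 3.** If a continuous function `F` on a 3-dimensional
space restricts to a quadratic form on every plane of a nonempty open set `𝒰` of
2-planes, then there is a unique quadratic form `Q` on `X` with `F|_P = Q|_P`
for all `P ∈ 𝒰`. -/
theorem quadratic_forms_in_3d
    {X : Type*} [NormedAddCommGroup X] [NormedSpace ℝ X]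
    (hX : Module.finrank ℝ X = 3) (F : X → ℝ) (hF : Continuous F)
    (𝒰 : Set (Gr 2 X)) (h𝒰open : IsOpen 𝒰) (h𝒰ne : 𝒰.Nonempty)
    (hq : ∀ P ∈ 𝒰, ∃ q : QuadraticForm ℝ P.1, ∀ w : P.1, F (w : X) = q w) :
    ∃! Q : QuadraticForm ℝ X, ∀ P ∈ 𝒰, ∀ w : P.1, F (w : X) = Q (w : X) := by
  classical
  let S : Set (X × X) := {p | LinearIndependent ℝ ![p.1, p.2] ∧
    ∃ P ∈ 𝒰, P.1 = Submodule.span ℝ (Set.range ![p.1, p.2])}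
  have hS : IsOpen S := by
    have h1 : IsOpen {v : Fin 2 → X | LinearIndependent ℝ v ∧
        ∃ P ∈ 𝒰, P.1 = Submodule.span ℝ (Set.range v)} := by
      have h2 := isOpen_coinduced.1 h𝒰open
      have h3 : IsOpen {v : Fin 2 → X | LinearIndependent ℝ v} :=
        isOpen_setOfPred_linearIndependent
      have h4 := h3.isOpenMap_subtype_val _ h2
      convert h4 using 1
      ext v
      constructor
      · rintro ⟨hv, P, hP, hPv⟩
        refine ⟨⟨v, hv⟩, ?_, rfl⟩
        have : P = ⟨Submodule.span ℝ (Set.range v), by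
          rw [finrank_span_eq_card hv, Fintype.card_fin]⟩ := Subtype.ext hPv
        rw [this] at hP
        exact hP
      · rintro ⟨⟨v', hv⟩, h, rfl⟩
        exact ⟨hv, _, h, rfl⟩
    exact h1.preimage (f := fun p : X × X => ![p.1, p.2]) (by fun_prop)
  have hpair : ∀ P ∈ 𝒰, ∀ w : P.1, w ≠ 0 → ∃ v, ((w : X), v) ∈ S := by
    intro P hP w hw
    have hP2 := P.2
    obtain ⟨v, hv⟩ := exists_linearIndependent_pair_of_one_lt_finrank
      (R := ℝ) (M := P.1) (by omega) hw
    have hv' : LinearIndependent ℝ ![(w : X), (v : X)] := by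
      have := hv.map' P.1.subtype (Submodule.ker_subtype _)
      have he : ![(w : X), (v : X)] = P.1.subtype ∘ ![w, v] := by
        funext i
        fin_cases i <;> rfl
      rw [he]
      exact this
    refine ⟨v, hv', P, hP, ?_⟩
    have : FiniteDimensional ℝ P.1 := Module.finite_of_finrank_eq_succ hP2
    symm
    apply Submodule.eq_of_le_of_finrank_eq
    · rw [Submodule.span_le]
      rintro _ ⟨i, rfl⟩
      fin_cases i
      · exact w.2
      · exact v.2
    · rw [finrank_span_eq_card hv', hP2, Fintype.card_fin]
  have hmem : ∀ u v, ∀ P : Gr 2 X, P.1 = Submodule.span ℝ (Set.range ![u, v]) →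
      u ∈ P.1 ∧ v ∈ P.1 := by
    intro u v P h
    rw [h]
    exact ⟨Submodule.subset_span ⟨0, rfl⟩, Submodule.subset_span ⟨1, rfl⟩⟩
  have hne : S.Nonempty := by
    obtain ⟨P, hP⟩ := h𝒰ne
    have hP2 := P.2
    have : Nontrivial P.1 := Module.nontrivial_of_finrank_pos (R := ℝ) (by omega)
    obtain ⟨w, hw⟩ := exists_ne (0 : P.1)
    obtain ⟨v, hv⟩ := hpair P hP w hw
    exact ⟨_, hv⟩
  obtain ⟨Q, hQ, huniq⟩ := aux_core hX F S hS hne (fun u v h => h.1) (by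
    rintro u v ⟨_, P, hP, h⟩
    obtain ⟨hu, hv⟩ := hmem u v P h
    obtain ⟨q, hq⟩ := hq P hP
    exact ⟨_, _, _, fun s t => (hq (s • ⟨u, hu⟩ + t • ⟨v, hv⟩)).trans (aux_q2 _ _ _ _ _)⟩)
  refine ⟨Q, ?_, fun Q' hQ' => huniq Q' ?_⟩
  · intro P hP w
    by_cases hw : w = 0
    · obtain ⟨q, hq⟩ := hq P hP
      rw [hq, hw]
      simp
    · obtain ⟨v, hv⟩ := hpair P hP w hw
      exact hQ _ _ hv
  · rintro u v ⟨_, P, hP, h⟩ s t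
    obtain ⟨hu, hv⟩ := hmem u v P h
    exact hQ' P hP (s • ⟨u, hu⟩ + t • ⟨v, hv⟩)
end
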